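/- (Numerical Factorization Theorem, part (ii): well-posedness) Let m ∈ ℕ^ℓ, m ≠ 0, let 𝔑 be a factorization structure of degree m and f̃ ∈ F^𝔑; for f ∈ ℙ^m put δ_f := dist(f, F^𝔑). Then there exist a neighborhood Ω of f̃ in ℙ^m and a constant L ≥ 0 such that: (a) every f ∈ Ω satisfies δ_f ≤ ‖f − f̃‖; (b) for every f ∈ Ω and every ε with δ_f < ε < θ_{f̃}/2, a numerical irreducible factorization of f within ε exists and any two numerical irreducible factorizations of f within ε have factorization distance 0 (uniqueness up to equivalence); (c) (Lipschitz continuity) for all f, f' ∈ Ω with ε ∈ (δ_f, θ_{f̃}/2) and ε' ∈ (δ_{f'}, θ_{f̃}/2), any numerical irreducible factorization of f within ε and any numerical irreducible factorization of f' within ε' have factorization distance at most L·‖f − f'‖. -/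

import Mathlib

open scoped Classical

/-- The Hermitian inner product on coefficients of multivariate polynomials
(conjugate-linear in the first argument). -/
noncomputable def pInner {ℓ : ℕ} (p q : MvPolynomial (Fin ℓ) ℂ) : ℂ :=
  ∑ d ∈ p.support ∪ q.support, (starRingEnd ℂ) (MvPolynomial.coeff d p) * MvPolynomial.coeff d q

/-- The coefficient norm `‖p‖ := √⟪p,p⟫`. -/
noncomputable def pNorm {ℓ : ℕ} (p : MvPolynomial (Fin ℓ) ℂ) : ℝ :=
  Real.sqrt (pInner p p).re

/-- The sine of the principal angle between the spans of two polynomials. -/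
noncomputable def psin {ℓ : ℕ} (p q : MvPolynomial (Fin ℓ) ℂ) : ℝ :=
  if p = 0 then (if q = 0 then 0 else 1)
  else if q = 0 then 1
  else pNorm (((pNorm p : ℂ))⁻¹ • p -
        (pInner q p / ((pNorm q : ℂ) * (pNorm p : ℂ))) • (((pNorm q : ℂ))⁻¹ • q))

/-- `(r, mdeg, k)` is a factorization structure of degree `m`: `r ≥ 1`, each `mdeg j ≠ 0`,
each `k j ≥ 1` and `Σ_j k_j · mdeg_j = m`. -/
def IsStruct {ℓ : ℕ} (m : Fin ℓ → ℕ) (r : ℕ) (mdeg : Fin r → Fin ℓ → ℕ)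
    (k : Fin r → ℕ) : Prop :=
  1 ≤ r ∧ (∀ j, mdeg j ≠ 0) ∧ (∀ j, 1 ≤ k j) ∧ (∀ t, ∑ j, k j * mdeg j t = m t)

/-- The factorization manifold `F^𝔐` of the structure `𝔐 = ((mdeg 1, k 1),…,(mdeg r, k r))`. -/
def FMset {ℓ : ℕ} (r : ℕ) (mdeg : Fin r → Fin ℓ → ℕ) (k : Fin r → ℕ) :
    Set (MvPolynomial (Fin ℓ) ℂ) :=
  {f | ∃ (β : ℂ) (g : Fin r → MvPolynomial (Fin ℓ) ℂ), β ≠ 0 ∧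
        (∀ i, Irreducible (g i)) ∧
        (∀ i t, (g i).degreeOf t = mdeg i t) ∧
        (∀ i j : Fin r, i ≠ j → ¬ Associated (g i) (g j)) ∧
        f = MvPolynomial.C β * ∏ i, g i ^ k i}

/-- `⟨n⟩ = ∏_t (n_t + 1)`, the dimension of `ℙ^n`. -/
def dimC {ℓ : ℕ} (n : Fin ℓ → ℕ) : ℕ := ∏ t, (n t + 1)

/-- The codimension `⟨m⟩ − (⟨m_1⟩ + ⋯ + ⟨m_r⟩ + 1 − r)` of a factorization manifold. -/
def codimOf {ℓ : ℕ} (m : Fin ℓ → ℕ) {r : ℕ} (mdeg : Fin r → Fin ℓ → ℕ) : ℤ :=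
  (dimC m : ℤ) - ((∑ j, (dimC (mdeg j) : ℤ)) + 1 - r)

/-- `dist(f, S) = inf_{g ∈ S} ‖f − g‖`, with value `+∞` for `S = ∅`. -/
noncomputable def distE {ℓ : ℕ} (f : MvPolynomial (Fin ℓ) ℂ)
    (S : Set (MvPolynomial (Fin ℓ) ℂ)) : ENNReal :=
  ⨅ g ∈ S, ENNReal.ofReal (pNorm (f - g))

/-- Closure of a set of polynomials in the coefficient-norm topology. -/
def pclosure {ℓ : ℕ} (S : Set (MvPolynomial (Fin ℓ) ℂ)) : Set (MvPolynomial (Fin ℓ) ℂ) :=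
  {f | ∀ ε : ℝ, 0 < ε → ∃ g ∈ S, pNorm (f - g) < ε}

/-- The critical gap `θ_f`: the infimum of `dist(f, F^𝔐)` over all factorization
structures `𝔐` of degree `m` with `f ∉ closure(F^𝔐)` (`+∞` if there are none). -/
noncomputable def theta {ℓ : ℕ} (m : Fin ℓ → ℕ) (f : MvPolynomial (Fin ℓ) ℂ) : ENNReal :=
  ⨅ (r : ℕ) (mdeg : Fin r → Fin ℓ → ℕ) (k : Fin r → ℕ)
    (_ : IsStruct m r mdeg k) (_ : f ∉ pclosure (FMset r mdeg k)),
    distE f (FMset r mdeg k)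

/-- `α·f_1^{k_1}⋯f_r^{k_r}` is a numerical irreducible factorization of `f` within `ε`:
the `f_j` are irreducible and pairwise non-associated, the structure
`𝔐 = ((deg f_1,k_1),…,(deg f_r,k_r))` is a factorization structure of degree `m` of
maximal codimension among structures `𝔑` of degree `m` with `dist(f,F^𝔑) < ε`, and
`min_γ ‖f − γ·f_1^{k_1}⋯f_r^{k_r}‖` is attained and equals `dist(f,F^𝔐) < ε`. -/
noncomputable def IsNIF {ℓ : ℕ} (m : Fin ℓ → ℕ) (f : MvPolynomial (Fin ℓ) ℂ) (ε : ℝ)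
    (α : ℂ) (r : ℕ) (fs : Fin r → MvPolynomial (Fin ℓ) ℂ) (ks : Fin r → ℕ) : Prop :=
  α ≠ 0 ∧ (∀ j, Irreducible (fs j)) ∧
  (∀ i j : Fin r, i ≠ j → ¬ Associated (fs i) (fs j)) ∧
  IsStruct m r (fun j t => (fs j).degreeOf t) ks ∧
  (∀ (r' : ℕ) (mdeg' : Fin r' → Fin ℓ → ℕ) (k' : Fin r' → ℕ),
    IsStruct m r' mdeg' k' → distE f (FMset r' mdeg' k') < ENNReal.ofReal ε →
    codimOf m mdeg' ≤ codimOf m (fun j t => (fs j).degreeOf t)) ∧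
  (∃ γ : ℂ,
    (∀ γ' : ℂ, pNorm (f - MvPolynomial.C γ * ∏ j, fs j ^ ks j) ≤
      pNorm (f - MvPolynomial.C γ' * ∏ j, fs j ^ ks j)) ∧
    ENNReal.ofReal (pNorm (f - MvPolynomial.C γ * ∏ j, fs j ^ ks j)) =
      distE f (FMset r (fun j t => (fs j).degreeOf t) ks)) ∧
  distE f (FMset r (fun j t => (fs j).degreeOf t) ks) < ENNReal.ofReal ε

/-- The full factor list (each factor repeated with its multiplicity) of a factorization. -/
def fullList {ℓ : ℕ} (r : ℕ) (fs : Fin r → MvPolynomial (Fin ℓ) ℂ) (ks : Fin r → ℕ) :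
    List (MvPolynomial (Fin ℓ) ℂ) :=
  (List.ofFn fun j => List.replicate (ks j) (fs j)).flatten

/-- The distance between two factorizations given by their full factor lists: `1` if the
lengths differ, otherwise the minimum over permutations `σ` of `max_j sin(p_j, q_{σ(j)})`. -/
noncomputable def factDistL {ℓ : ℕ} (l₁ l₂ : List (MvPolynomial (Fin ℓ) ℂ)) : ℝ :=
  if h : l₁.length = l₂.length then
    if h0 : 0 < l₁.length then
      (Finset.univ : Finset (Equiv.Perm (Fin l₁.length))).inf' ⟨1, Finset.mem_univ _⟩
        (fun σ => (Finset.univ : Finset (Fin l₁.length)).sup' ⟨⟨0, h0⟩, Finset.mem_univ _⟩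
          (fun j => psin (l₁.get j) (l₂.get (Fin.cast h (σ j)))))
    else 0
  else 1

section Algebra

variable {ℓ : ℕ}

/-- A nonzero polynomial of multidegree zero is a unit. -/
theorem isUnit_of_degreeOf_eq_zero {p : MvPolynomial (Fin ℓ) ℂ} (hp : p ≠ 0)
    (h : ∀ t, p.degreeOf t = 0) : IsUnit p := by
  have hC : p = MvPolynomial.C (p.coeff 0) := by
    rw [← MvPolynomial.totalDegree_eq_zero_iff_eq_C, MvPolynomial.totalDegree_eq_zero_iff]
    intro d hd t
    have := MvPolynomial.monomial_le_degreeOf t hd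
    have := h t
    omega
  rw [hC]
  refine (IsUnit.mk0 _ fun h0 => hp ?_).map MvPolynomial.C
  rw [hC, h0, map_zero]

theorem degreeOf_eq_zero_of_isUnit {p : MvPolynomial (Fin ℓ) ℂ} (hp : IsUnit p) (t : Fin ℓ) :
    p.degreeOf t = 0 := by
  obtain ⟨c, -, rfl⟩ := MvPolynomial.isUnit_iff_eq_C_of_isReduced.1 hp
  exact MvPolynomial.degreeOf_C c t

/-- Associated polynomials are scalar multiples of each other. -/
theorem exists_smul_of_associated {p q : MvPolynomial (Fin ℓ) ℂ} (h : Associated p q) :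
    ∃ c : ℂ, c ≠ 0 ∧ p = c • q := by
  obtain ⟨u, hu⟩ := h.symm
  obtain ⟨c, hc, hcu⟩ := MvPolynomial.isUnit_iff_eq_C_of_isReduced.1 u.isUnit
  refine ⟨c, hc.ne_zero, ?_⟩
  rw [← hu, hcu, mul_comm, MvPolynomial.smul_eq_C_mul]

theorem associated_smul {c : ℂ} (hc : c ≠ 0) (p : MvPolynomial (Fin ℓ) ℂ) :
    Associated p (c • p) := by
  rw [MvPolynomial.smul_eq_C_mul]
  exact associated_unit_mul_right p _ ((IsUnit.mk0 c hc).map MvPolynomial.C)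

theorem degreeOf_smul_eq {c : ℂ} (hc : c ≠ 0) (p : MvPolynomial (Fin ℓ) ℂ) (t : Fin ℓ) :
    (c • p).degreeOf t = p.degreeOf t := by
  rw [MvPolynomial.smul_eq_C_mul]
  exact MvPolynomial.degreeOf_C_mul t c (mem_nonZeroDivisors_of_ne_zero hc)

/-- An irreducible polynomial involving a single variable is linear in it. -/
theorem degreeOf_eq_one_of_irreducible {g : MvPolynomial (Fin ℓ) ℂ} (hg : Irreducible g)
    (t : Fin ℓ) (h : ∀ s, s ≠ t → g.degreeOf s = 0) : g.degreeOf t = 1 := by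
  have hrep : ∃ q : Polynomial ℂ, g = Polynomial.aeval (MvPolynomial.X t) q := by
    have hmem : g ∈ Algebra.adjoin ℂ {(MvPolynomial.X t : MvPolynomial (Fin ℓ) ℂ)} := by
      have hv : g ∈ MvPolynomial.supported ℂ ({t} : Set (Fin ℓ)) := by
        rw [MvPolynomial.mem_supported]
        intro s hs
        by_contra hst
        exact MvPolynomial.mem_vars_iff_degreeOf_ne_zero.1 (by simpa using hs) (h s hst)
      simpa [MvPolynomial.supported] using hv
    rw [Algebra.adjoin_singleton_eq_range_aeval] at hmem
    obtain ⟨q, hq⟩ := hmem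
    exact ⟨q, hq.symm⟩
  obtain ⟨q, hq⟩ := hrep
  have hdeg : q.degree ≠ 0 := by
    intro h0
    rw [Polynomial.eq_C_of_degree_eq_zero h0, Polynomial.aeval_C] at hq
    refine hg.not_isUnit (isUnit_of_degreeOf_eq_zero hg.ne_zero fun s => ?_)
    rw [hq]
    exact MvPolynomial.degreeOf_C _ s
  obtain ⟨z, hz⟩ := IsAlgClosed.exists_root q hdeg
  obtain ⟨q', rfl⟩ := Polynomial.dvd_iff_isRoot.2 hz
  rw [map_mul, map_sub, Polynomial.aeval_X, Polynomial.aeval_C] at hq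
  have hlin : ((MvPolynomial.X t : MvPolynomial (Fin ℓ) ℂ) -
      algebraMap ℂ (MvPolynomial (Fin ℓ) ℂ) z).degreeOf t = 1 := by
    rw [MvPolynomial.algebraMap_eq, sub_eq_add_neg,
      MvPolynomial.degreeOf_add_eq_of_degreeOf_lt, MvPolynomial.degreeOf_X_self]
    rw [MvPolynomial.degreeOf_neg, MvPolynomial.degreeOf_C, MvPolynomial.degreeOf_X_self]
    exact one_pos
  have hne := hg.ne_zero
  rw [hq] at hne
  rcases hg.isUnit_or_isUnit hq with hu | hu
  · have := degreeOf_eq_zero_of_isUnit hu t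
    omega
  · rw [hq, MvPolynomial.degreeOf_mul_eq (left_ne_zero_of_mul hne) (right_ne_zero_of_mul hne),
      hlin, degreeOf_eq_zero_of_isUnit hu t]

theorem one_le_dimC (n : Fin ℓ → ℕ) : 1 ≤ dimC n :=
  Finset.prod_pos fun _ _ => Nat.succ_pos _

theorem dimC_mono {a b : Fin ℓ → ℕ} (h : a ≤ b) : dimC a ≤ dimC b :=
  Finset.prod_le_prod' fun t _ => Nat.succ_le_succ (h t)

theorem prod_add_one_superadditive (s : Finset (Fin ℓ)) (a b : Fin ℓ → ℕ) :
    (∏ t ∈ s, (a t + 1)) + ∏ t ∈ s, (b t + 1) ≤ (∏ t ∈ s, (a t + b t + 1)) + 1 := by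
  induction s using Finset.induction_on with
  | empty => simp
  | insert t s ht ih =>
    rw [Finset.prod_insert ht, Finset.prod_insert ht, Finset.prod_insert ht]
    have ha : ∏ t ∈ s, (a t + 1) ≤ ∏ t ∈ s, (a t + b t + 1) :=
      Finset.prod_le_prod' fun t _ => by omega
    have hb : ∏ t ∈ s, (b t + 1) ≤ ∏ t ∈ s, (a t + b t + 1) :=
      Finset.prod_le_prod' fun t _ => by omega
    nlinarith [Nat.mul_le_mul_left (a t) ha, Nat.mul_le_mul_left (b t) hb]

theorem dimC_superadditive (a b : Fin ℓ → ℕ) : dimC a + dimC b ≤ dimC (a + b) + 1 :=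
  prod_add_one_superadditive Finset.univ a b

theorem dimC_superadditive_strict {a b : Fin ℓ → ℕ} {s t : Fin ℓ} (hst : s ≠ t)
    (ha : a s ≠ 0) (hb : b t ≠ 0) : dimC a + dimC b < dimC (a + b) + 1 := by
  have key := prod_add_one_superadditive (Finset.univ.erase t) a b
  have hlt : ∏ i ∈ Finset.univ.erase t, (b i + 1) < ∏ i ∈ Finset.univ.erase t, (a i + b i + 1) :=
    Finset.prod_lt_prod (fun i _ => Nat.succ_pos _) (fun i _ => by omega)
      ⟨s, by simp [hst], by omega⟩
  have hle : ∏ i ∈ Finset.univ.erase t, (a i + 1) ≤ ∏ i ∈ Finset.univ.erase t, (a i + b i + 1) :=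
    Finset.prod_le_prod' fun i _ => by omega
  simp only [dimC, Pi.add_apply]
  rw [← Finset.mul_prod_erase _ _ (Finset.mem_univ t),
    ← Finset.mul_prod_erase _ (fun i => b i + 1) (Finset.mem_univ t),
    ← Finset.mul_prod_erase _ (fun i => a i + b i + 1) (Finset.mem_univ t)]
  nlinarith [Nat.mul_le_mul_left (a t) hle,
    Nat.mul_lt_mul_of_pos_left hlt (Nat.pos_of_ne_zero hb)]

/-- If `a + b` is the multidegree of an irreducible polynomial and `a, b ≠ 0`, then
`⟨a + b⟩ - 1 > (⟨a⟩ - 1) + (⟨b⟩ - 1)`. -/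
theorem dimC_lt_of_irreducible {a b : Fin ℓ → ℕ} (ha : a ≠ 0) (hb : b ≠ 0)
    {g : MvPolynomial (Fin ℓ) ℂ} (hg : Irreducible g) (hdeg : ∀ t, g.degreeOf t = a t + b t) :
    dimC a + dimC b < dimC (a + b) + 1 := by
  obtain ⟨s, hs⟩ := Function.ne_iff.1 ha
  by_cases h : ∃ t, s ≠ t ∧ b t ≠ 0
  · obtain ⟨t, hst, ht⟩ := h
    exact dimC_superadditive_strict hst hs ht
  push Not at h
  have hbs : b s ≠ 0 := by
    obtain ⟨t, ht⟩ := Function.ne_iff.1 hb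
    by_cases hst : s = t
    · rwa [hst]
    · exact absurd (h t hst) ht
  by_cases h' : ∃ t, t ≠ s ∧ a t ≠ 0
  · obtain ⟨t, hst, ht⟩ := h'
    exact dimC_superadditive_strict hst ht hbs
  push Not at h'
  have h1 := degreeOf_eq_one_of_irreducible hg s fun t hts => by
    rw [hdeg, h t hts.symm, h' t hts]
  rw [hdeg] at h1
  simp only [Pi.zero_apply] at hs
  omega

theorem sum_dimC_le {ι : Type*} (s : Finset ι) (d : ι → Fin ℓ → ℕ) :
    ∑ i ∈ s, (dimC (d i) - 1) ≤ dimC (∑ i ∈ s, d i) - 1 := by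
  induction s using Finset.induction_on with
  | empty => simp
  | insert i s hi ih =>
    rw [Finset.sum_insert hi, Finset.sum_insert hi]
    have h1 := dimC_superadditive (d i) (∑ i ∈ s, d i)
    have h2 := one_le_dimC (d i)
    have h3 := one_le_dimC (∑ i ∈ s, d i)
    omega

end Algebra

section Structure

variable {ℓ : ℕ}

theorem codimOf_eq (m : Fin ℓ → ℕ) {r : ℕ} (d : Fin r → Fin ℓ → ℕ) :
    codimOf m d = (dimC m : ℤ) - 1 - ((∑ j, (dimC (d j) - 1) : ℕ) : ℤ) := by
  have h : ((∑ j, (dimC (d j) - 1) : ℕ) : ℤ) = (∑ j, (dimC (d j) : ℤ)) - r := by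
    push_cast [one_le_dimC]
    simp
  rw [codimOf, h]
  ring

/-- The multidegree of a polynomial. -/
noncomputable def multideg (p : MvPolynomial (Fin ℓ) ℂ) : Fin ℓ → ℕ := fun t => p.degreeOf t

theorem multideg_mul {p q : MvPolynomial (Fin ℓ) ℂ} (hp : p ≠ 0) (hq : q ≠ 0) :
    multideg (p * q) = multideg p + multideg q :=
  funext fun _ => MvPolynomial.degreeOf_mul_eq hp hq

theorem multideg_prod {ι : Type*} (s : Finset ι) {p : ι → MvPolynomial (Fin ℓ) ℂ}
    (hp : ∀ i ∈ s, p i ≠ 0) : multideg (∏ i ∈ s, p i) = ∑ i ∈ s, multideg (p i) := by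
  funext t
  rw [Finset.sum_apply]
  exact MvPolynomial.degreeOf_prod_eq s p hp

theorem multideg_le_of_dvd {p q : MvPolynomial (Fin ℓ) ℂ} (hq : q ≠ 0) (h : p ∣ q) :
    multideg p ≤ multideg q := by
  obtain ⟨u, rfl⟩ := h
  rw [multideg_mul (left_ne_zero_of_mul hq) (right_ne_zero_of_mul hq)]
  exact fun t => Nat.le_add_right _ _

theorem multideg_ne_zero_of_irreducible {p : MvPolynomial (Fin ℓ) ℂ} (hp : Irreducible p) :
    multideg p ≠ 0 := fun h =>
  hp.not_isUnit (isUnit_of_degreeOf_eq_zero hp.ne_zero fun t => congrFun h t)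

/-- If an irreducible factor `p` and further factors with product `∏ p i` divide `h`, and `h` has the
multidegree of an irreducible polynomial, then dimensions add up strictly unless `h` is
associated to `p`. -/
theorem associated_of_sum_dimC_ge {ι : Type*} {h p : MvPolynomial (Fin ℓ) ℂ} (hh : h ≠ 0)
    (hp : Irreducible p) (hirr : ∃ g, Irreducible g ∧ multideg g = multideg h)
    (s : Finset ι) {q : ι → MvPolynomial (Fin ℓ) ℂ} (hdvd : p * ∏ i ∈ s, q i ∣ h)
    (hsum : dimC (multideg h) - 1 ≤
      (dimC (multideg p) - 1) + ∑ i ∈ s, (dimC (multideg (q i)) - 1)) :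
    Associated h p := by
  obtain ⟨u, rfl⟩ := hdvd
  have hqu : (∏ i ∈ s, q i) * u ≠ 0 := by
    rw [mul_assoc] at hh
    exact right_ne_zero_of_mul hh
  have hq : ∀ i ∈ s, q i ≠ 0 := Finset.prod_ne_zero_iff.1 (left_ne_zero_of_mul hqu)
  rw [mul_assoc] at hh hsum hirr ⊢
  rw [multideg_mul hp.ne_zero hqu] at hsum hirr
  obtain ⟨g, hg, hgd⟩ := hirr
  by_cases h0 : multideg ((∏ i ∈ s, q i) * u) = 0
  · exact associated_mul_unit_left _ _
      (isUnit_of_degreeOf_eq_zero hqu fun t => congrFun h0 t)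
  · exfalso
    have h1 := dimC_lt_of_irreducible (multideg_ne_zero_of_irreducible hp) h0 hg
      fun t => congrFun hgd t
    have h2 : multideg (∏ i ∈ s, q i) ≤ multideg ((∏ i ∈ s, q i) * u) :=
      multideg_le_of_dvd hqu (Dvd.intro _ rfl)
    rw [multideg_prod s hq] at h2
    have h3 := dimC_mono h2
    have h4 := sum_dimC_le s fun i => multideg (q i)
    have h5 := one_le_dimC (multideg p)
    have h6 := one_le_dimC (multideg ((∏ i ∈ s, q i) * u))
    omega

/-- Comparison of the irreducible factorization `α ∏ pᵢ ^ nᵢ` with another factorization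
`γ ∏ hⱼ ^ kⱼ` whose factors have multidegrees of irreducible polynomials: the codimension of the
second one is at most that of the first one, with equality only if the factors agree. -/
theorem codimOf_le_of_factorization (m : Fin ℓ → ℕ) {s r : ℕ}
    {p : Fin s → MvPolynomial (Fin ℓ) ℂ} {n : Fin s → ℕ} {α : ℂ}
    {h : Fin r → MvPolynomial (Fin ℓ) ℂ} {k : Fin r → ℕ} {γ : ℂ}
    (hp : ∀ i, Irreducible (p i)) (hpa : ∀ i j, i ≠ j → ¬ Associated (p i) (p j))
    (hn : ∀ i, 1 ≤ n i) (hk : ∀ j, 1 ≤ k j) (hα : α ≠ 0)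
    (hirr : ∀ j, ∃ g, Irreducible g ∧ multideg g = multideg (h j))
    (heq : α • ∏ i, p i ^ n i = γ • ∏ j, h j ^ k j) :
    codimOf m (fun j => multideg (h j)) ≤ codimOf m (fun i => multideg (p i)) ∧
    (codimOf m (fun i => multideg (p i)) ≤ codimOf m (fun j => multideg (h j)) →
      ∃ e : Fin r ≃ Fin s, ∀ j, Associated (h j) (p (e j)) ∧ k j = n (e j)) := by
  have hne : γ • ∏ j, h j ^ k j ≠ 0 := by
    rw [← heq]
    exact smul_ne_zero hα (Finset.prod_ne_zero_iff.2 fun i _ => pow_ne_zero _ (hp i).ne_zero)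
  have hγ : γ ≠ 0 := left_ne_zero_of_smul hne
  have hh : ∀ j, h j ≠ 0 := fun j hj => by
    refine right_ne_zero_of_smul hne (Finset.prod_eq_zero (Finset.mem_univ j) ?_)
    rw [hj, zero_pow (Nat.one_le_iff_ne_zero.1 (hk j))]
  have hassoc : Associated (∏ i, p i ^ n i) (∏ j, h j ^ k j) := by
    have h1 := associated_smul hα (∏ i, p i ^ n i)
    rw [heq] at h1
    exact h1.trans (associated_smul hγ _).symm
  have hex : ∀ i, ∃ j, p i ∣ h j := fun i => by
    have hd1 : p i ∣ p i ^ n i := dvd_pow_self _ (Nat.one_le_iff_ne_zero.1 (hn i))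
    have hd2 : p i ^ n i ∣ ∏ i, p i ^ n i :=
      Finset.dvd_prod_of_mem (fun i => p i ^ n i) (Finset.mem_univ i)
    have hd : p i ∣ ∏ j, h j ^ k j := (hd1.trans hd2).trans hassoc.dvd
    obtain ⟨j, -, hj⟩ := (hp i).prime.exists_mem_finset_dvd hd
    exact ⟨j, (hp i).prime.dvd_of_dvd_pow hj⟩
  choose J hJ using hex
  have hfib : ∀ j, ∏ i ∈ Finset.univ.filter (fun i => J i = j), p i ∣ h j := fun j => by
    refine Finset.prod_dvd_of_isRelPrime ?_ ?_
    · intro i _ i' _ hii'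
      exact (hp i).isRelPrime_iff_not_dvd.2 fun hd =>
        hpa i i' hii' ((hp i).associated_of_dvd (hp i') hd)
    · intro i hi
      rw [← (Finset.mem_filter.1 hi).2]
      exact hJ i
  have hfibdim : ∀ j, ∑ i ∈ Finset.univ.filter (fun i => J i = j), (dimC (multideg (p i)) - 1) ≤
      dimC (multideg (h j)) - 1 := fun j => by
    refine (sum_dimC_le _ _).trans (Nat.sub_le_sub_right (dimC_mono ?_) 1)
    rw [← multideg_prod _ fun i _ => (hp i).ne_zero]
    exact multideg_le_of_dvd (hh j) (hfib j)
  have hfibsum : ∑ i, (dimC (multideg (p i)) - 1) =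
      ∑ j, ∑ i ∈ Finset.univ.filter (fun i => J i = j), (dimC (multideg (p i)) - 1) :=
    (Finset.sum_fiberwise _ _ _).symm
  have hle : ∑ i, (dimC (multideg (p i)) - 1) ≤ ∑ j, (dimC (multideg (h j)) - 1) := by
    rw [hfibsum]
    exact Finset.sum_le_sum fun j _ => hfibdim j
  rw [codimOf_eq, codimOf_eq]
  refine ⟨by omega, fun hge => ?_⟩
  have hEq : ∀ j, ∑ i ∈ Finset.univ.filter (fun i => J i = j), (dimC (multideg (p i)) - 1) =
      dimC (multideg (h j)) - 1 := fun j =>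
    (Finset.sum_eq_sum_iff_of_le fun j _ => hfibdim j).1
      (by rw [← hfibsum]; omega) j (Finset.mem_univ j)
  have hassJ : ∀ i, Associated (h (J i)) (p i) := fun i => by
    have hi : i ∈ Finset.univ.filter (fun i' => J i' = J i) := by simp
    refine associated_of_sum_dimC_ge (hh _) (hp i) (hirr _)
      ((Finset.univ.filter (fun i' => J i' = J i)).erase i) (q := p) ?_ ?_
    · rw [Finset.mul_prod_erase _ _ hi]
      exact hfib _
    · rw [Finset.add_sum_erase _ (fun i => dimC (multideg (p i)) - 1) hi]
      exact (hEq _).ge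
  have hinj : Function.Injective J := fun i i' hii' => by
    by_contra hne'
    exact hpa i i' hne' ((hassJ i).symm.trans (hii' ▸ hassJ i'))
  have hsurj : Function.Surjective J := fun j => by
    by_contra hj
    push Not at hj
    have h0 := hEq j
    rw [Finset.filter_false_of_mem fun i _ => hj i, Finset.sum_empty] at h0
    obtain ⟨g, hg, hgd⟩ := hirr j
    have hnz := multideg_ne_zero_of_irreducible hg
    rw [hgd] at hnz
    obtain ⟨t, ht⟩ := Function.ne_iff.1 hnz
    have h2 : multideg (h j) t + 1 ≤ dimC (multideg (h j)) :=
      Nat.le_of_dvd (one_le_dimC _)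
        (Finset.dvd_prod_of_mem (fun t => multideg (h j) t + 1) (Finset.mem_univ t))
    simp only [Pi.zero_apply] at ht
    omega
  let e := Equiv.ofBijective J ⟨hinj, hsurj⟩
  have hass : ∀ j, Associated (h j) (p (e.symm j)) := fun j => by
    have := hassJ (e.symm j)
    rwa [show J (e.symm j) = j from e.apply_symm_apply j] at this
  refine ⟨e.symm, fun j => ⟨hass j, ?_⟩⟩
  have hassoc2 : Associated (∏ i, p i ^ n i) (∏ i, p i ^ k (e i)) := by
    refine hassoc.trans ?_
    rw [← e.prod_comp]
    exact Associated.prod _ _ _ fun i _ => (by simpa using hass (e i) : Associated _ _).pow_pow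
  have hmult : ∀ (a : Fin s → ℕ) (i : Fin s), emultiplicity (p i) (∏ i', p i' ^ a i') = a i := by
    intro a i
    rw [Finset.emultiplicity_prod (hp i).prime, Finset.sum_eq_single i]
    · rw [emultiplicity_pow_self (hp i).ne_zero (hp i).not_isUnit]
    · intro b _ hb
      rw [emultiplicity_pow (hp i).prime, emultiplicity_eq_zero.2, mul_zero]
      exact fun hd => hpa i b hb.symm ((hp i).associated_of_dvd (hp b) hd)
    · simp
  have h1 := hmult n (e.symm j)
  rw [emultiplicity_eq_of_associated_right hassoc2, hmult] at h1
  simpa using h1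
end Structure

section Norms

variable {ℓ : ℕ}

theorem pInner_eq_sum_of_subset {p q : MvPolynomial (Fin ℓ) ℂ} {s : Finset (Fin ℓ →₀ ℕ)}
    (hs : p.support ∪ q.support ⊆ s) :
    pInner p q = ∑ d ∈ s, (starRingEnd ℂ) (p.coeff d) * q.coeff d :=
  Finset.sum_subset hs fun d _ hd => by
    rw [MvPolynomial.notMem_support_iff.1 fun h => hd (Finset.mem_union_left _ h), map_zero,
      zero_mul]

/-- Polynomials, to be equipped with the Hermitian inner product of their coefficients. -/
def L2Poly (ℓ : ℕ) : Type := MvPolynomial (Fin ℓ) ℂ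

noncomputable instance : AddCommGroup (L2Poly ℓ) :=
  inferInstanceAs (AddCommGroup (MvPolynomial (Fin ℓ) ℂ))

noncomputable instance : Module ℂ (L2Poly ℓ) :=
  inferInstanceAs (Module ℂ (MvPolynomial (Fin ℓ) ℂ))

/-- The identity map from polynomials to `L2Poly`. -/
noncomputable def toL2 (ℓ : ℕ) : MvPolynomial (Fin ℓ) ℂ →ₗ[ℂ] L2Poly ℓ := LinearMap.id

theorem pInner_self_re (p : MvPolynomial (Fin ℓ) ℂ) :
    (pInner p p).re = ∑ d ∈ p.support, ‖p.coeff d‖ ^ 2 := by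
  rw [pInner_eq_sum_of_subset (Finset.union_idempotent p.support).subset, Complex.re_sum]
  refine Finset.sum_congr rfl fun d _ => ?_
  rw [← Complex.normSq_eq_conj_mul_self, Complex.ofReal_re, Complex.normSq_eq_norm_sq]

theorem pInner_conj_symm (p q : MvPolynomial (Fin ℓ) ℂ) :
    (starRingEnd ℂ) (pInner q p) = pInner p q := by
  simp only [pInner, map_sum, map_mul, Complex.conj_conj]
  rw [Finset.union_comm]
  exact Finset.sum_congr rfl fun d _ => mul_comm _ _

theorem pInner_add_left (p q u : MvPolynomial (Fin ℓ) ℂ) :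
    pInner (p + q) u = pInner p u + pInner q u := by
  rw [pInner_eq_sum_of_subset (s := p.support ∪ q.support ∪ u.support),
    pInner_eq_sum_of_subset (s := p.support ∪ q.support ∪ u.support),
    pInner_eq_sum_of_subset (s := p.support ∪ q.support ∪ u.support), ← Finset.sum_add_distrib]
  · refine Finset.sum_congr rfl fun d _ => ?_
    rw [MvPolynomial.coeff_add, map_add, add_mul]
  · exact Finset.union_subset_union_left Finset.subset_union_right
  · exact Finset.union_subset_union_left Finset.subset_union_left
  · exact Finset.union_subset_union_left MvPolynomial.support_add

theorem pInner_smul_left (p q : MvPolynomial (Fin ℓ) ℂ) (c : ℂ) :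
    pInner (c • p) q = (starRingEnd ℂ) c * pInner p q := by
  rw [pInner_eq_sum_of_subset (Finset.union_subset_union_left MvPolynomial.support_smul), pInner,
    Finset.mul_sum]
  refine Finset.sum_congr rfl fun d _ => ?_
  rw [MvPolynomial.coeff_smul, smul_eq_mul, map_mul, mul_assoc]

theorem pInner_self_re_nonneg (p : MvPolynomial (Fin ℓ) ℂ) : 0 ≤ (pInner p p).re := by
  rw [pInner_self_re]
  positivity

theorem eq_zero_of_pInner_self {p : MvPolynomial (Fin ℓ) ℂ} (hp : pInner p p = 0) : p = 0 := by
  have h : ∑ d ∈ p.support, ‖p.coeff d‖ ^ 2 = 0 := by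
    rw [← pInner_self_re, hp, Complex.zero_re]
  have hz := (Finset.sum_eq_zero_iff_of_nonneg fun d _ => by positivity).1 h
  refine MvPolynomial.ext _ _ fun d => ?_
  by_cases hd : d ∈ p.support
  · simpa using hz d hd
  · simpa using hd

/-- The Hermitian inner product structure of `L2Poly`. -/
noncomputable abbrev L2Poly.core (ℓ : ℕ) : InnerProductSpace.Core ℂ (L2Poly ℓ) where
  inner p q := pInner (ℓ := ℓ) p q
  conj_inner_symm p q := pInner_conj_symm (ℓ := ℓ) p q
  re_inner_nonneg p := pInner_self_re_nonneg (ℓ := ℓ) p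
  add_left p q u := pInner_add_left (ℓ := ℓ) p q u
  smul_left p q c := pInner_smul_left (ℓ := ℓ) p q c
  definite _ hp := eq_zero_of_pInner_self (ℓ := ℓ) hp

noncomputable instance : NormedAddCommGroup (L2Poly ℓ) := (L2Poly.core ℓ).toNormedAddCommGroup

noncomputable instance : InnerProductSpace ℂ (L2Poly ℓ) := .ofCore (L2Poly.core ℓ).toCore

theorem inner_toL2 (p q : MvPolynomial (Fin ℓ) ℂ) :
    inner ℂ (toL2 ℓ p) (toL2 ℓ q) = pInner p q := rfl

theorem norm_toL2 (p : MvPolynomial (Fin ℓ) ℂ) : ‖toL2 ℓ p‖ = pNorm p := rfl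

theorem toL2_injective : Function.Injective (toL2 ℓ) := fun _ _ h => h

theorem pNorm_nonneg (p : MvPolynomial (Fin ℓ) ℂ) : 0 ≤ pNorm p := Real.sqrt_nonneg _

theorem pNorm_pos {p : MvPolynomial (Fin ℓ) ℂ} (hp : p ≠ 0) : 0 < pNorm p := by
  rw [← norm_toL2, norm_pos_iff]
  exact fun h => hp (toL2_injective (h.trans (map_zero _).symm))

theorem pNorm_sub_comm (p q : MvPolynomial (Fin ℓ) ℂ) : pNorm (p - q) = pNorm (q - p) := by
  rw [← norm_toL2, ← norm_toL2, map_sub, map_sub, norm_sub_rev]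

theorem pNorm_sub_le (p q u : MvPolynomial (Fin ℓ) ℂ) :
    pNorm (p - u) ≤ pNorm (p - q) + pNorm (q - u) := by
  rw [← norm_toL2, ← norm_toL2, ← norm_toL2, map_sub, map_sub, map_sub]
  exact norm_sub_le_norm_sub_add_norm_sub _ _ _

theorem pNorm_smul (c : ℂ) (p : MvPolynomial (Fin ℓ) ℂ) : pNorm (c • p) = ‖c‖ * pNorm p := by
  rw [← norm_toL2, map_smul, norm_smul, norm_toL2]

theorem pNorm_monomial (d : Fin ℓ →₀ ℕ) (c : ℂ) :
    pNorm (MvPolynomial.monomial d c) = ‖c‖ := by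
  have h : (pInner (MvPolynomial.monomial d c) (MvPolynomial.monomial d c)).re = ‖c‖ ^ 2 := by
    rw [pInner_eq_sum_of_subset (s := {d}), Finset.sum_singleton, MvPolynomial.coeff_monomial,
      if_pos rfl, ← Complex.normSq_eq_conj_mul_self, Complex.ofReal_re, Complex.normSq_eq_norm_sq]
    rw [Finset.union_idempotent]
    exact MvPolynomial.support_monomial_subset
  rw [pNorm, h, Real.sqrt_sq (norm_nonneg c)]

/-- The sum of the absolute values of the coefficients. -/
noncomputable def l1Norm (p : MvPolynomial (Fin ℓ) ℂ) : ℝ := ∑ d ∈ p.support, ‖p.coeff d‖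

theorem l1Norm_eq_sum_of_subset {p : MvPolynomial (Fin ℓ) ℂ} {s : Finset (Fin ℓ →₀ ℕ)}
    (hs : p.support ⊆ s) : l1Norm p = ∑ d ∈ s, ‖p.coeff d‖ :=
  Finset.sum_subset hs fun d _ hd => by
    rw [MvPolynomial.notMem_support_iff.1 hd, norm_zero]

theorem l1Norm_add_le (p q : MvPolynomial (Fin ℓ) ℂ) : l1Norm (p + q) ≤ l1Norm p + l1Norm q := by
  rw [l1Norm_eq_sum_of_subset MvPolynomial.support_add,
    l1Norm_eq_sum_of_subset (Finset.subset_union_left (s₂ := q.support)),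
    l1Norm_eq_sum_of_subset (Finset.subset_union_right (s₁ := p.support)),
    ← Finset.sum_add_distrib]
  exact Finset.sum_le_sum fun d _ => norm_add_le _ _

theorem l1Norm_zero : l1Norm (0 : MvPolynomial (Fin ℓ) ℂ) = 0 := by simp [l1Norm]

theorem l1Norm_sum_le {ι : Type*} (s : Finset ι) (p : ι → MvPolynomial (Fin ℓ) ℂ) :
    l1Norm (∑ i ∈ s, p i) ≤ ∑ i ∈ s, l1Norm (p i) :=
  Finset.le_sum_of_subadditive l1Norm l1Norm_zero.le l1Norm_add_le s p

theorem l1Norm_monomial (d : Fin ℓ →₀ ℕ) (c : ℂ) :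
    l1Norm (MvPolynomial.monomial d c) = ‖c‖ := by
  rw [l1Norm_eq_sum_of_subset MvPolynomial.support_monomial_subset, Finset.sum_singleton,
    MvPolynomial.coeff_monomial, if_pos rfl]

theorem l1Norm_mul_le (p q : MvPolynomial (Fin ℓ) ℂ) : l1Norm (p * q) ≤ l1Norm p * l1Norm q := by
  rw [MvPolynomial.mul_def]
  refine (l1Norm_sum_le _ _).trans ?_
  rw [l1Norm, Finset.sum_mul]
  refine Finset.sum_le_sum fun d _ => (l1Norm_sum_le _ _).trans ?_
  rw [l1Norm, Finset.mul_sum]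
  refine Finset.sum_le_sum fun e _ => ?_
  rw [l1Norm_monomial]
  exact norm_mul_le _ _

theorem l1Norm_smul (c : ℂ) (p : MvPolynomial (Fin ℓ) ℂ) : l1Norm (c • p) = ‖c‖ * l1Norm p := by
  rw [l1Norm_eq_sum_of_subset MvPolynomial.support_smul, l1Norm, Finset.mul_sum]
  exact Finset.sum_congr rfl fun d _ => by rw [MvPolynomial.coeff_smul, norm_smul]

theorem norm_coeff_le_l1Norm (p : MvPolynomial (Fin ℓ) ℂ) (d : Fin ℓ →₀ ℕ) :
    ‖p.coeff d‖ ≤ l1Norm p := by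
  by_cases hd : d ∈ p.support
  · exact Finset.single_le_sum (f := fun d => ‖p.coeff d‖) (fun _ _ => norm_nonneg _) hd
  · rw [MvPolynomial.notMem_support_iff.1 hd, norm_zero]
    exact Finset.sum_nonneg fun _ _ => norm_nonneg _

theorem pNorm_le_l1Norm (p : MvPolynomial (Fin ℓ) ℂ) : pNorm p ≤ l1Norm p := by
  rw [← norm_toL2, l1Norm]
  nth_rw 1 [p.as_sum]
  rw [map_sum]
  refine (norm_sum_le _ _).trans (Finset.sum_le_sum fun d _ => ?_)
  rw [norm_toL2, pNorm_monomial]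

/-- The `ℓ¹` normed algebra structure on polynomials. -/
noncomputable abbrev l1NormedCommRing (ℓ : ℕ) : NormedCommRing (MvPolynomial (Fin ℓ) ℂ) where
  __ := AddGroupNorm.toNormedAddCommGroup
    { toFun := l1Norm
      map_zero' := l1Norm_zero
      add_le' := l1Norm_add_le
      neg' := fun p => by
        rw [← neg_one_smul ℂ p, l1Norm_smul, norm_neg, norm_one, one_mul]
      eq_zero_of_map_eq_zero' := fun p hp => MvPolynomial.ext _ _ fun d => by
        have := norm_coeff_le_l1Norm p d
        rw [MvPolynomial.coeff_zero, ← norm_le_zero_iff]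
        exact this.trans hp.le }
  __ := (inferInstance : CommRing (MvPolynomial (Fin ℓ) ℂ))
  norm_mul_le := l1Norm_mul_le

attribute [local instance] l1NormedCommRing

/-- The `ℓ¹` normed algebra structure on polynomials. -/
noncomputable abbrev l1NormedAlgebra (ℓ : ℕ) : NormedAlgebra ℂ (MvPolynomial (Fin ℓ) ℂ) where
  __ := (inferInstance : Algebra ℂ (MvPolynomial (Fin ℓ) ℂ))
  norm_smul_le := fun c p => (l1Norm_smul c p).le

attribute [local instance] l1NormedAlgebra

/-- The uniform structure of the `ℓ¹` norm. -/
noncomputable abbrev l1UniformSpace (ℓ : ℕ) : UniformSpace (MvPolynomial (Fin ℓ) ℂ) :=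
  (l1NormedCommRing ℓ).toPseudoMetricSpace.toUniformSpace

attribute [local instance] l1UniformSpace

/-- `toL2` as a continuous linear map. -/
noncomputable def toL2CLM (ℓ : ℕ) : MvPolynomial (Fin ℓ) ℂ →L[ℂ] L2Poly ℓ :=
  (toL2 ℓ).mkContinuous 1 fun p => by
    rw [one_mul]
    exact pNorm_le_l1Norm p


end Norms

section NearestPoint

variable {X V : Type*} [NormedAddCommGroup X] [NormedSpace ℝ X]
  [NormedAddCommGroup V] [InnerProductSpace ℝ V]

/-- At a local minimum of `‖f - Φ‖` the residual is orthogonal to the range of the derivative. -/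
theorem inner_fderiv_eq_zero_of_isLocalMin {Φ : X → V} {f : V} {x : X}
    (hΦ : DifferentiableAt ℝ Φ x) (hmin : IsLocalMin (fun y => ‖f - Φ y‖) x) (u : X) :
    inner ℝ (f - Φ x) (fderiv ℝ Φ x u) = 0 := by
  have hd : HasFDerivAt (fun y => f - Φ y) (-fderiv ℝ Φ x) x := hΦ.hasFDerivAt.const_sub f
  have hmin2 : IsLocalMin (fun y => ‖f - Φ y‖ ^ 2) x :=
    hmin.mono fun y hy => pow_le_pow_left₀ (norm_nonneg _) hy 2
  have h0 := congrArg (fun A => A u) (hmin2.hasFDerivAt_eq_zero hd.norm_sq)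
  rw [inner_sub_left]
  simp at h0
  linarith

/-- Near an immersed point of a `C²` map, the parameters of nearest points depend on the data in a
Lipschitz way. -/
theorem exists_lipschitz_nearest_point [FiniteDimensional ℝ X] {Φ : X → V}
    (hΦ : ContDiff ℝ 2 Φ) (x₀ : X) (hinj : Function.Injective (fderiv ℝ Φ x₀)) :
    ∃ η > 0, ∃ ρ > 0, ∃ L ≥ 0, ∀ (f f' : V) (x x' : X), ‖x - x₀‖ < η → ‖x' - x₀‖ < η →
      ‖f' - Φ x'‖ ≤ ρ → IsLocalMin (fun y => ‖f - Φ y‖) x →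
      IsLocalMin (fun y => ‖f' - Φ y‖) x' → ‖x - x'‖ ≤ L * ‖f - f'‖ := by
  set D := fderiv ℝ Φ x₀ with hD
  obtain ⟨K, hK0, hK⟩ := (D : X →ₗ[ℝ] V).exists_antilipschitzWith (LinearMap.ker_eq_bot.2 hinj)
  have hKpos : (0 : ℝ) < K := hK0
  have hbound : ∀ u, ‖u‖ ≤ K * ‖D u‖ := fun u => by
    simpa [dist_eq_norm] using hK.le_mul_dist u 0
  have hdiff : ContDiff ℝ 1 (fderiv ℝ Φ) := hΦ.fderiv_right (by norm_num)
  obtain ⟨C, t, ht, hC⟩ := hdiff.contDiffAt (x := x₀) |>.exists_lipschitzOnWith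
  set τ : ℝ := 1 / (4 * K) with hτ
  have hτ0 : 0 < τ := by positivity
  have hstrict : HasStrictFDerivAt Φ D x₀ := hΦ.contDiffAt.hasStrictFDerivAt (by norm_num)
  have hs := hstrict.isLittleO.def hτ0
  have hcont : ∀ᶠ x in nhds x₀, ‖fderiv ℝ Φ x - D‖ < τ := by
    have := hdiff.continuous.continuousAt (x := x₀) |>.eventually (Metric.ball_mem_nhds _ hτ0)
    simpa [dist_eq_norm] using this
  rw [nhds_prod_eq, Filter.eventually_prod_self_iff'] at hs
  obtain ⟨s, hs_mem, hs'⟩ := hs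
  obtain ⟨η, hη, hball⟩ := Metric.mem_nhds_iff.1
    (Filter.inter_mem (Filter.inter_mem ht hs_mem) hcont)
  have hmem : ∀ x, ‖x - x₀‖ < η → (x ∈ t ∧ x ∈ s) ∧ ‖fderiv ℝ Φ x - D‖ < τ :=
    fun x hx => hball (by simpa [dist_eq_norm] using hx)
  refine ⟨η, hη, 1 / (8 * (C + 1) * K ^ 2), by positivity, 10 * K, by positivity, ?_⟩
  intro f f' x x' hx hx' hρ hmin hmin'
  obtain ⟨⟨hxt, hxs⟩, hxD⟩ := hmem x hx
  obtain ⟨⟨hxt', hxs'⟩, -⟩ := hmem x' hx'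
  have hdΦ : ∀ y, DifferentiableAt ℝ Φ y := fun y => hΦ.differentiable (by norm_num) y
  set u := x - x' with hu
  have h1 := inner_fderiv_eq_zero_of_isLocalMin (hdΦ x) hmin u
  have h2 := inner_fderiv_eq_zero_of_isLocalMin (hdΦ x') hmin' u
  set w := ‖D u‖ with hw
  have hw0 : 0 ≤ w := norm_nonneg _
  have hKu : ‖u‖ ≤ K * w := hbound u
  have hτu : τ * ‖u‖ ≤ w / 4 := by
    calc τ * ‖u‖ ≤ τ * (K * w) := by gcongr
      _ = w / 4 := by rw [hτ]; field_simp
  set e₁ := Φ x - Φ x' - D u with he₁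
  set e₂ := fderiv ℝ Φ x u - D u with he₂
  have he₁n : ‖e₁‖ ≤ w / 4 := le_trans (hs' x hxs x' hxs') hτu
  have he₂n : ‖e₂‖ ≤ w / 4 := by
    refine le_trans ?_ hτu
    exact ((fderiv ℝ Φ x - D).le_opNorm u).trans (by gcongr)
  have hsplit : inner ℝ (Φ x - Φ x') (fderiv ℝ Φ x u) = inner ℝ (f - f') (fderiv ℝ Φ x u) +
      inner ℝ (f' - Φ x') (fderiv ℝ Φ x u - fderiv ℝ Φ x' u) := by
    rw [inner_sub_left] at h1 h2
    simp only [inner_sub_left, inner_sub_right]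
    linarith
  have hlow : w ^ 2 - w * (w / 4) - (w / 4) * w - (w / 4) * (w / 4) ≤
      inner ℝ (Φ x - Φ x') (fderiv ℝ Φ x u) := by
    have hΦe : Φ x - Φ x' = D u + e₁ := by rw [he₁]; abel
    have hDe : fderiv ℝ Φ x u = D u + e₂ := by rw [he₂]; abel
    rw [hΦe, hDe, inner_add_left, inner_add_right, inner_add_right, real_inner_self_eq_norm_sq]
    have i1 := (abs_le.1 (abs_real_inner_le_norm (D u) e₂)).1
    have i2 := (abs_le.1 (abs_real_inner_le_norm e₁ (D u))).1
    have i3 := (abs_le.1 (abs_real_inner_le_norm e₁ e₂)).1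
    have j1 : ‖D u‖ * ‖e₂‖ ≤ w * (w / 4) := by gcongr
    have j2 : ‖e₁‖ * ‖D u‖ ≤ w / 4 * w := by gcongr
    have j3 : ‖e₁‖ * ‖e₂‖ ≤ w / 4 * (w / 4) := by gcongr
    linarith
  have hup1 : inner ℝ (f - f') (fderiv ℝ Φ x u) ≤ ‖f - f'‖ * (5 / 4 * w) := by
    refine (real_inner_le_norm _ _).trans (mul_le_mul_of_nonneg_left ?_ (norm_nonneg _))
    have hDe : fderiv ℝ Φ x u = D u + e₂ := by rw [he₂]; abel
    rw [hDe]
    linarith [norm_add_le (D u) e₂]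
  have hup2 : inner ℝ (f' - Φ x') (fderiv ℝ Φ x u - fderiv ℝ Φ x' u) ≤ w ^ 2 / 8 := by
    have hlip : ‖fderiv ℝ Φ x u - fderiv ℝ Φ x' u‖ ≤ C * ‖u‖ * ‖u‖ := by
      refine ((fderiv ℝ Φ x - fderiv ℝ Φ x').le_opNorm u).trans ?_
      gcongr
      simpa [dist_eq_norm] using hC.dist_le_mul x hxt x' hxt'
    calc _ ≤ ‖f' - Φ x'‖ * ‖fderiv ℝ Φ x u - fderiv ℝ Φ x' u‖ := real_inner_le_norm _ _
      _ ≤ 1 / (8 * (C + 1) * K ^ 2) * (C * (K * w) * (K * w)) := by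
          gcongr
          exact hlip.trans (by gcongr)
      _ = C / (C + 1) * (w ^ 2 / 8) := by field_simp
      _ ≤ 1 * (w ^ 2 / 8) := by
          gcongr
          rw [div_le_one (by positivity)]
          linarith
      _ = w ^ 2 / 8 := one_mul _
  have hfinal : w ≤ 10 * ‖f - f'‖ := by
    by_contra hlt
    push Not at hlt
    have hwpos : 0 < w := lt_of_le_of_lt (by positivity) hlt
    nlinarith [mul_lt_mul_of_pos_right hlt hwpos]
  calc ‖u‖ ≤ K * w := hKu
    _ ≤ K * (10 * ‖f - f'‖) := by gcongr
    _ = 10 * K * ‖f - f'‖ := by ring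

end NearestPoint

section Compactness

variable {ℓ : ℕ}

attribute [local instance] l1NormedCommRing l1NormedAlgebra
attribute [local instance] l1UniformSpace

/-- The space of polynomials of multidegree at most `n`. -/
noncomputable def boxPoly (n : Fin ℓ → ℕ) : Submodule ℂ (MvPolynomial (Fin ℓ) ℂ) :=
  MvPolynomial.restrictSupport ℂ {d | ∀ t, d t ≤ n t}

theorem mem_boxPoly {n : Fin ℓ → ℕ} {p : MvPolynomial (Fin ℓ) ℂ} :
    p ∈ boxPoly n ↔ ∀ t, p.degreeOf t ≤ n t := by
  rw [boxPoly, MvPolynomial.mem_restrictSupport_iff]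
  constructor
  · exact fun h t => MvPolynomial.degreeOf_le_iff.2 fun d hd => h hd t
  · exact fun h d hd t => MvPolynomial.degreeOf_le_iff.1 (h t) d hd

instance (n : Fin ℓ → ℕ) : FiniteDimensional ℂ (boxPoly n) := by
  have hfin : ({d | ∀ t, d t ≤ n t} : Set (Fin ℓ →₀ ℕ)).Finite := by
    refine (Set.finite_Iic (Finsupp.equivFunOnFinite.symm n)).subset fun d hd t => ?_
    simpa using hd t
  have := hfin.to_subtype
  exact (MvPolynomial.basisRestrictSupport ℂ _).finiteDimensional_of_finite

/-- Unit vectors (in the `ℓ¹` norm) of multidegree at most `n`. -/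
def boxSphere (n : Fin ℓ → ℕ) : Set (MvPolynomial (Fin ℓ) ℂ) :=
  {p | (∀ t, p.degreeOf t ≤ n t) ∧ ‖p‖ = 1}

theorem isCompact_boxSphere (n : Fin ℓ → ℕ) : IsCompact (boxSphere n) := by
  have : ProperSpace (boxPoly n) := FiniteDimensional.proper ℂ _
  have h := (isCompact_sphere (0 : boxPoly n) 1).image continuous_subtype_val
  convert h using 1
  ext p
  constructor
  · exact fun hp => ⟨⟨p, mem_boxPoly.2 hp.1⟩, by simpa using hp.2, rfl⟩
  · rintro ⟨q, hq, rfl⟩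
    exact ⟨mem_boxPoly.1 q.2, by simpa using hq⟩

theorem ne_zero_of_mem_boxSphere {n : Fin ℓ → ℕ} {p : MvPolynomial (Fin ℓ) ℂ}
    (hp : p ∈ boxSphere n) : p ≠ 0 := fun h => by
  have := hp.2
  rw [h, norm_zero] at this
  exact zero_ne_one this

/-- Every nonzero polynomial is a nonzero multiple of an `ℓ¹` unit vector. -/
theorem exists_smul_mem_boxSphere {n : Fin ℓ → ℕ} {p : MvPolynomial (Fin ℓ) ℂ} (hp : p ≠ 0)
    (hdeg : ∀ t, p.degreeOf t ≤ n t) : ∃ c : ℂ, c ≠ 0 ∧ ∃ q ∈ boxSphere n, p = c • q := by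
  have hn : (‖p‖ : ℂ) ≠ 0 := by simpa using hp
  refine ⟨‖p‖, hn, (‖p‖ : ℂ)⁻¹ • p, ⟨fun t => ?_, ?_⟩, ?_⟩
  · rw [degreeOf_smul_eq (inv_ne_zero hn)]
    exact hdeg t
  · rw [norm_smul, norm_inv, Complex.norm_real, norm_norm, inv_mul_cancel₀ (by simpa using hp)]
  · rw [smul_inv_smul₀ hn]

/-- Compactness principle: approximate solutions of `f = γ • Ψ h` with `h` in a compact set lie in
any open set containing the exact solutions. -/
theorem exists_approx_mem_of_isCompact {Y : Type*} [TopologicalSpace Y] {K : Set Y}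
    (hK : IsCompact K) {Ψ : Y → MvPolynomial (Fin ℓ) ℂ} (hΨ : Continuous Ψ)
    (hΨ0 : ∀ y ∈ K, Ψ y ≠ 0) (f : MvPolynomial (Fin ℓ) ℂ) {O : Set (ℂ × Y)} (hO : IsOpen O)
    (hsol : ∀ γ, ∀ y ∈ K, f = γ • Ψ y → (γ, y) ∈ O) :
    ∃ ρ > 0, ∀ γ, ∀ y ∈ K, pNorm (f - γ • Ψ y) < ρ → (γ, y) ∈ O := by
  have hcont : Continuous fun y => pNorm (Ψ y) :=
    ((toL2CLM ℓ).continuous.comp hΨ).norm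
  obtain ⟨c, hc, hcK⟩ : ∃ c > 0, ∀ y ∈ K, c ≤ pNorm (Ψ y) := by
    rcases K.eq_empty_or_nonempty with rfl | hne
    · exact ⟨1, one_pos, by simp⟩
    · obtain ⟨y₀, hy₀, hmin⟩ := hK.exists_isMinOn hne hcont.continuousOn
      exact ⟨pNorm (Ψ y₀), pNorm_pos (hΨ0 y₀ hy₀), fun y hy => hmin hy⟩
  set R := (pNorm f + 1) / c with hR
  have hcont2 : Continuous fun z : ℂ × Y => pNorm (f - z.1 • Ψ z.2) :=
    ((toL2CLM ℓ).continuous.comp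
      (continuous_const.sub (continuous_fst.smul (hΨ.comp continuous_snd)))).norm
  have hS : IsCompact ((Metric.closedBall (0 : ℂ) R ×ˢ K) \ O) :=
    ((isCompact_closedBall _ _).prod hK).diff hO
  obtain ⟨ρ, hρ, hρS⟩ : ∃ ρ > 0, ∀ z ∈ (Metric.closedBall (0 : ℂ) R ×ˢ K) \ O,
      ρ ≤ pNorm (f - z.1 • Ψ z.2) := by
    rcases ((Metric.closedBall (0 : ℂ) R ×ˢ K) \ O).eq_empty_or_nonempty with h | hne
    · exact ⟨1, one_pos, by simp [h]⟩
    · obtain ⟨z₀, hz₀, hmin⟩ := hS.exists_isMinOn hne hcont2.continuousOn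
      refine ⟨_, pNorm_pos fun h0 => hz₀.2 ?_, fun z hz => hmin hz⟩
      exact hsol z₀.1 z₀.2 hz₀.1.2 (sub_eq_zero.1 h0)
  refine ⟨min ρ 1, lt_min hρ one_pos, fun γ y hy hlt => ?_⟩
  by_contra hnot
  refine absurd (hρS (γ, y) ⟨⟨?_, hy⟩, hnot⟩) (not_le.2 (hlt.trans_le (min_le_left _ _)))
  have h1 : pNorm (γ • Ψ y) ≤ pNorm f + 1 := by
    have h2 := norm_le_norm_add_norm_sub (toL2 ℓ f) (toL2 ℓ (γ • Ψ y))
    rw [← map_sub, norm_toL2, norm_toL2, norm_toL2] at h2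
    linarith [hlt.trans_le (min_le_right ρ 1)]
  rw [pNorm_smul] at h1
  rw [mem_closedBall_zero_iff, hR, le_div_iff₀ hc]
  exact (mul_le_mul_of_nonneg_left (hcK y hy) (norm_nonneg γ)).trans h1

end Compactness

section Local

variable {ℓ : ℕ}

attribute [local instance] l1NormedCommRing l1NormedAlgebra
attribute [local instance] l1UniformSpace

theorem continuous_pInner_right (p : MvPolynomial (Fin ℓ) ℂ) :
    Continuous fun q : MvPolynomial (Fin ℓ) ℂ => pInner p q :=
  (continuous_const (y := toL2 ℓ p)).inner (toL2CLM ℓ).continuous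

theorem pInner_smul_right (p q : MvPolynomial (Fin ℓ) ℂ) (c : ℂ) :
    pInner p (c • q) = c * pInner p q := by
  rw [← inner_toL2, map_smul, inner_smul_right, inner_toL2]

theorem pInner_add_right (p q u : MvPolynomial (Fin ℓ) ℂ) :
    pInner p (q + u) = pInner p q + pInner p u := by
  rw [← inner_toL2, map_add, inner_add_right, inner_toL2, inner_toL2]

theorem pInner_self_of_pNorm_eq_one {p : MvPolynomial (Fin ℓ) ℂ} (hp : pNorm p = 1) :
    pInner p p = 1 := by
  rw [← inner_toL2, inner_self_eq_norm_sq_to_K, norm_toL2, hp]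
  simp

theorem multideg_smul {c : ℂ} (hc : c ≠ 0) (p : MvPolynomial (Fin ℓ) ℂ) :
    multideg (c • p) = multideg p :=
  funext fun t => degreeOf_smul_eq hc p t

theorem prod_smul_pow {r : ℕ} (c : Fin r → ℂ) (h : Fin r → MvPolynomial (Fin ℓ) ℂ)
    (k : Fin r → ℕ) : ∏ j, (c j • h j) ^ k j = (∏ j, c j ^ k j) • ∏ j, h j ^ k j := by
  simp only [smul_pow, Finset.prod_smul]

theorem prod_pow_ne_zero {r : ℕ} {h : Fin r → MvPolynomial (Fin ℓ) ℂ} (hh : ∀ j, h j ≠ 0)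
    (k : Fin r → ℕ) : ∏ j, h j ^ k j ≠ 0 :=
  Finset.prod_ne_zero_iff.2 fun j _ => pow_ne_zero _ (hh j)

theorem degreeOf_smul_prod_pow {r : ℕ} {h : Fin r → MvPolynomial (Fin ℓ) ℂ} (hh : ∀ j, h j ≠ 0)
    (k : Fin r → ℕ) {γ : ℂ} (hγ : γ ≠ 0) (t : Fin ℓ) :
    (γ • ∏ j, h j ^ k j).degreeOf t = ∑ j, k j * (h j).degreeOf t := by
  rw [degreeOf_smul_eq hγ, MvPolynomial.degreeOf_prod_eq _ _ fun j _ => pow_ne_zero _ (hh j)]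
  exact Finset.sum_congr rfl fun j _ => MvPolynomial.degreeOf_pow_eq t _ _ (hh j)

/-- Factors of bounded multidegree whose product has full multidegree attain the bounds. -/
theorem multideg_eq_of_isStruct {m : Fin ℓ → ℕ} {r : ℕ} {mdeg : Fin r → Fin ℓ → ℕ}
    {k : Fin r → ℕ} (hS : IsStruct m r mdeg k) {h : Fin r → MvPolynomial (Fin ℓ) ℂ}
    (hh : ∀ j, h j ≠ 0) (hle : ∀ j t, (h j).degreeOf t ≤ mdeg j t) {γ : ℂ} (hγ : γ ≠ 0)
    (hdeg : ∀ t, (γ • ∏ j, h j ^ k j).degreeOf t = m t) (j : Fin r) :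
    multideg (h j) = mdeg j := by
  funext t
  have hsum : ∑ j, k j * (h j).degreeOf t = ∑ j, k j * mdeg j t := by
    rw [← degreeOf_smul_prod_pow hh k hγ, hdeg, hS.2.2.2]
  have := (Finset.sum_eq_sum_iff_of_le fun j _ => Nat.mul_le_mul_left (k j) (hle j t)).1 hsum j
    (Finset.mem_univ j)
  exact Nat.eq_of_mul_eq_mul_left (hS.2.2.1 j) this

/-- A family of polynomials in boxes is, up to scalars, a family of unit vectors. -/
theorem exists_smul_mem_pi_boxSphere {r : ℕ} {mdeg : Fin r → Fin ℓ → ℕ}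
    {F : Fin r → MvPolynomial (Fin ℓ) ℂ} (hF : ∀ j, F j ≠ 0)
    (hle : ∀ j t, (F j).degreeOf t ≤ mdeg j t) :
    ∃ u : Fin r → ℂ, (∀ j, u j ≠ 0) ∧ ∃ h ∈ Set.pi Set.univ fun j => boxSphere (mdeg j),
      ∀ j, F j = u j • h j := by
  choose u hu h hh hF using fun j => exists_smul_mem_boxSphere (hF j) (hle j)
  exact ⟨u, hu, h, fun j _ => hh j, hF⟩

theorem continuous_prod_pow {r : ℕ} (k : Fin r → ℕ) :
    Continuous fun h : Fin r → MvPolynomial (Fin ℓ) ℂ => ∏ j, h j ^ k j :=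
  continuous_finsetProd _ fun j _ => (continuous_apply j).pow _

/-- Comparison of structures whose manifold accumulates at a factored polynomial. -/
theorem codimOf_le_of_mem_pclosure {m : Fin ℓ → ℕ} {s r : ℕ}
    {p : Fin s → MvPolynomial (Fin ℓ) ℂ} {n : Fin s → ℕ} {α : ℂ}
    (hp : ∀ i, Irreducible (p i)) (hpa : ∀ i j, i ≠ j → ¬ Associated (p i) (p j))
    (hα : α ≠ 0) (hN : IsStruct m s (fun i => multideg (p i)) n)
    {mdeg : Fin r → Fin ℓ → ℕ} {k : Fin r → ℕ} (hS : IsStruct m r mdeg k)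
    (hcl : α • ∏ i, p i ^ n i ∈ pclosure (FMset r mdeg k)) :
    codimOf m mdeg ≤ codimOf m (fun i => multideg (p i)) ∧
    (codimOf m (fun i => multideg (p i)) ≤ codimOf m mdeg →
      ∃ e : Fin r ≃ Fin s, ∀ j, mdeg j = multideg (p (e j)) ∧ k j = n (e j)) := by
  obtain ⟨γ, h, hmem, heq⟩ : ∃ γ : ℂ, ∃ h ∈ Set.pi Set.univ fun j => boxSphere (mdeg j),
      α • ∏ i, p i ^ n i = γ • ∏ j, h j ^ k j := by
    by_contra hno
    push Not at hno
    obtain ⟨ρ, hρ, hempty⟩ := exists_approx_mem_of_isCompact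
      (isCompact_univ_pi fun j => isCompact_boxSphere (mdeg j)) (continuous_prod_pow k)
      (fun h hh => prod_pow_ne_zero (fun j => ne_zero_of_mem_boxSphere (hh j trivial)) k)
      (α • ∏ i, p i ^ n i) (O := ∅) isOpen_empty fun γ h hh heq => hno γ h hh heq
    obtain ⟨g, ⟨β, F, -, hF, hFd, -, rfl⟩, hlt⟩ := hcl ρ hρ
    obtain ⟨u, -, h, hh, hFu⟩ :=
      exists_smul_mem_pi_boxSphere (fun j => (hF j).ne_zero) fun j t => (hFd j t).le
    refine hempty (β * ∏ j, u j ^ k j) h hh ?_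
    rw [mul_smul, ← prod_smul_pow, MvPolynomial.smul_eq_C_mul _ β]
    simpa only [← hFu] using hlt
  have hh0 : ∀ j, h j ≠ 0 := fun j => ne_zero_of_mem_boxSphere (hmem j trivial)
  have hγ : γ ≠ 0 := by
    rintro rfl
    rw [zero_smul] at heq
    exact smul_ne_zero hα (prod_pow_ne_zero (fun i => (hp i).ne_zero) n) heq
  have hdeg : ∀ j, multideg (h j) = mdeg j := multideg_eq_of_isStruct hS hh0
    (fun j => (hmem j trivial).1) hγ fun t => by
      rw [← heq, degreeOf_smul_prod_pow (fun i => (hp i).ne_zero) n hα]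
      exact hN.2.2.2 t
  obtain ⟨g, ⟨β, F, -, hF, hFd, -, -⟩, -⟩ := hcl 1 one_pos
  have hmain := codimOf_le_of_factorization m hp hpa hN.2.2.1 hS.2.2.1 hα
    (fun j => ⟨F j, hF j, (funext (hFd j)).trans (hdeg j).symm⟩) heq
  simp only [hdeg] at hmain
  refine ⟨hmain.1, fun hge => ?_⟩
  obtain ⟨e, he⟩ := hmain.2 hge
  refine ⟨e, fun j => ⟨?_, (he j).2⟩⟩
  obtain ⟨c, hc, hcp⟩ := exists_smul_of_associated (he j).1
  rw [← hdeg j, hcp, multideg_smul hc]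


/-- Factorizations close to `α ∏ pᵢ ^ nᵢ` with the same structure have, after permuting and scaling
their factors, factors close to the `pᵢ`. -/
theorem exists_factors_near {m : Fin ℓ → ℕ} {s : ℕ}
    {p : Fin s → MvPolynomial (Fin ℓ) ℂ} {n : Fin s → ℕ} {α : ℂ}
    (hp : ∀ i, Irreducible (p i)) (hpa : ∀ i j, i ≠ j → ¬ Associated (p i) (p j))
    (hα : α ≠ 0) (hN : IsStruct m s (fun i => multideg (p i)) n) (hp1 : ∀ i, pNorm (p i) = 1)
    {η : ℝ} (hη : 0 < η) :
    ∃ ρ > 0, ∀ (γ : ℂ) (F : Fin s → MvPolynomial (Fin ℓ) ℂ), (∀ j, F j ≠ 0) →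
      (∀ j, multideg (F j) = multideg (p j)) →
      pNorm (α • ∏ i, p i ^ n i - γ • ∏ j, F j ^ n j) < ρ →
      ∃ (σ : Equiv.Perm (Fin s)) (q : Fin s → MvPolynomial (Fin ℓ) ℂ) (a : ℂ), ‖a‖ < η ∧
        γ • ∏ j, F j ^ n j = ((1 + a) * α) • ∏ i, q i ^ n i ∧
        ∀ i, n (σ i) = n i ∧ multideg (q i) = multideg (p i) ∧ ‖q i - p i‖ < η ∧
          pInner (p i) (q i) = 1 ∧ ∃ c : ℂ, c ≠ 0 ∧ q i = c • F (σ i) := by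
  let O : Equiv.Perm (Fin s) → Set (ℂ × (Fin s → MvPolynomial (Fin ℓ) ℂ)) := fun e =>
    {z | (∀ j, ‖z.2 j - pInner (p (e j)) (z.2 j) • p (e j)‖ < η * ‖pInner (p (e j)) (z.2 j)‖) ∧
      ‖z.1 * ∏ j, pInner (p (e j)) (z.2 j) ^ n j - α‖ < η * ‖α‖}
  have hin : ∀ e : Equiv.Perm (Fin s), ∀ j, Continuous
      fun z : ℂ × (Fin s → MvPolynomial (Fin ℓ) ℂ) => pInner (p (e j)) (z.2 j) := fun e j =>
    (continuous_pInner_right _).comp ((continuous_apply j).comp continuous_snd)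
  have hOpen : ∀ e, IsOpen (O e) := fun e => by
    refine IsOpen.and (isOpen_iff_mem_nhds.2 fun z hz => ?_) ?_
    · refine Filter.eventually_all.2 fun j => IsOpen.mem_nhds (isOpen_lt ?_ ?_) (hz j)
      · exact (((continuous_apply j).comp continuous_snd).sub
          ((hin e j).smul continuous_const)).norm
      · exact continuous_const.mul (hin e j).norm
    · refine isOpen_lt ?_ continuous_const
      exact ((continuous_fst.mul (continuous_finsetProd _ fun j _ =>
        (hin e j).pow _)).sub continuous_const).norm
  let good : Set (Equiv.Perm (Fin s)) :=
    {e | ∀ j, n (e j) = n j ∧ multideg (p (e j)) = multideg (p j)}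
  have hp0 : ∏ i, p i ^ n i ≠ 0 := prod_pow_ne_zero (fun i => (hp i).ne_zero) n
  obtain ⟨ρ, hρ, hmem⟩ := exists_approx_mem_of_isCompact
    (isCompact_univ_pi fun j => isCompact_boxSphere (multideg (p j))) (continuous_prod_pow n)
    (fun h hh => prod_pow_ne_zero (fun j => ne_zero_of_mem_boxSphere (hh j trivial)) n)
    (α • ∏ i, p i ^ n i) (O := ⋃ e ∈ good, O e)
    (isOpen_biUnion fun e _ => hOpen e) (by
      intro γ h hh heq
      have hh0 : ∀ j, h j ≠ 0 := fun j => ne_zero_of_mem_boxSphere (hh j trivial)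
      have hγ : γ ≠ 0 := by
        rintro rfl
        rw [zero_smul] at heq
        exact smul_ne_zero hα hp0 heq
      have hdeg : ∀ j, multideg (h j) = multideg (p j) := multideg_eq_of_isStruct hN hh0
        (fun j => (hh j trivial).1) hγ fun t => by
          rw [← heq, degreeOf_smul_prod_pow (fun i => (hp i).ne_zero) n hα]
          exact hN.2.2.2 t
      obtain ⟨-, hmain⟩ := codimOf_le_of_factorization m hp hpa hN.2.2.1 hN.2.2.1 hα
        (fun j => ⟨p j, hp j, (hdeg j).symm⟩) heq
      simp only [hdeg, le_refl, forall_const] at hmain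
      obtain ⟨e, he⟩ := hmain
      choose c hc hcp using fun j => exists_smul_of_associated (he j).1
      have hinner : ∀ j, pInner (p (e j)) (h j) = c j := fun j => by
        rw [hcp j, pInner_smul_right, pInner_self_of_pNorm_eq_one (hp1 _), mul_one]
      refine Set.mem_biUnion (x := e) (fun j => ⟨(he j).2.symm, ?_⟩) ⟨fun j => ?_, ?_⟩
      · rw [← hdeg j, hcp j, multideg_smul (hc j)]
      · simp only [hinner, ← hcp, sub_self, norm_zero]
        exact mul_pos hη (norm_pos_iff.2 (hc j))
      · have hprod : ∏ j, h j ^ n j = (∏ j, c j ^ n j) • ∏ i, p i ^ n i := by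
          rw [← e.prod_comp fun i => p i ^ n i]
          simp only [← fun j => (he j).2]
          rw [← prod_smul_pow]
          simp only [← hcp]
        rw [hprod, smul_smul] at heq
        simp only [hinner]
        rw [← smul_left_injective ℂ hp0 heq, sub_self, norm_zero]
        exact mul_pos hη (norm_pos_iff.2 hα))
  refine ⟨ρ, hρ, fun γ F hF hFd hlt => ?_⟩
  obtain ⟨u, hu, h, hh, hFu⟩ := exists_smul_mem_pi_boxSphere hF fun j t => (congrFun (hFd j) t).le
  have hFh : γ • ∏ j, F j ^ n j = (γ * ∏ j, u j ^ n j) • ∏ j, h j ^ n j := by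
    rw [mul_smul, ← prod_smul_pow]
    simp only [← hFu]
  rw [hFh] at hlt ⊢
  obtain ⟨e, he, hO1, hO2⟩ := Set.mem_iUnion₂.1 (hmem _ h hh hlt)
  simp only at hO1 hO2
  set c : Fin s → ℂ := fun j => pInner (p (e j)) (h j) with hcdef
  have hc : ∀ j, c j ≠ 0 := fun j hcj => by
    have h1 := hO1 j
    rw [show pInner (p (e j)) (h j) = 0 from hcj, norm_zero, mul_zero] at h1
    exact absurd h1 (not_lt.2 (norm_nonneg _))
  refine ⟨e.symm, fun i => (c (e.symm i))⁻¹ • h (e.symm i),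
    (γ * ∏ j, u j ^ n j) * (∏ j, c j ^ n j) / α - 1, ?_, ?_, fun i => ?_⟩
  · have : (γ * ∏ j, u j ^ n j) * (∏ j, c j ^ n j) / α - 1 =
        ((γ * ∏ j, u j ^ n j) * (∏ j, c j ^ n j) - α) / α := by field_simp
    rw [this, norm_div, div_lt_iff₀ (norm_pos_iff.2 hα)]
    exact hO2
  · have hprod : ∏ i, ((c (e.symm i))⁻¹ • h (e.symm i)) ^ n i =
        (∏ j, (c j)⁻¹ ^ n j) • ∏ j, h j ^ n j := by
      rw [← Equiv.prod_comp e, ← prod_smul_pow]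
      exact Finset.prod_congr rfl fun j _ => by rw [e.symm_apply_apply, (he j).1]
    have hcancel : (∏ j, c j ^ n j) * ∏ j, (c j)⁻¹ ^ n j = 1 := by
      rw [← Finset.prod_mul_distrib]
      exact Finset.prod_eq_one fun j _ => by rw [← mul_pow, mul_inv_cancel₀ (hc j), one_pow]
    rw [hprod, smul_smul]
    congr 1
    rw [add_sub_cancel, div_mul_cancel₀ _ hα, mul_assoc, hcancel, mul_one]
  · obtain ⟨j, rfl⟩ := e.surjective i
    simp only [e.symm_apply_apply]
    refine ⟨(he j).1.symm, ?_, ?_, ?_, (c j)⁻¹ * (u j)⁻¹,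
      mul_ne_zero (inv_ne_zero (hc j)) (inv_ne_zero (hu j)), ?_⟩
    · rw [(he j).2, ← hFd j, hFu j, multideg_smul (inv_ne_zero (hc j)), multideg_smul (hu j)]
    · have : (c j)⁻¹ • h j - p (e j) = (c j)⁻¹ • (h j - c j • p (e j)) := by
        rw [smul_sub, inv_smul_smul₀ (hc j)]
      rw [this, norm_smul, norm_inv, inv_mul_lt_iff₀ (norm_pos_iff.2 (hc j)), mul_comm]
      exact hO1 j
    · rw [pInner_smul_right]
      exact inv_mul_cancel₀ (hc j)
    · rw [mul_smul, hFu j, inv_smul_smul₀ (hu j)]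

end Local

section Openness

open scoped Topology

variable {ℓ : ℕ}

attribute [local instance] l1NormedCommRing l1NormedAlgebra
attribute [local instance] l1UniformSpace

theorem continuous_coeff (d : Fin ℓ →₀ ℕ) :
    Continuous fun p : MvPolynomial (Fin ℓ) ℂ => p.coeff d :=
  AddMonoidHomClass.continuous_of_bound (MvPolynomial.lcoeff ℂ d) 1 fun p => by
    rw [one_mul]
    exact norm_coeff_le_l1Norm p d

/-- Small perturbations that do not raise the degrees keep the multidegree. -/
theorem eventually_multideg_eq {p : MvPolynomial (Fin ℓ) ℂ} (hp : p ≠ 0) :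
    ∀ᶠ q in 𝓝 p, q ∈ boxPoly (multideg p) → multideg q = multideg p := by
  have hex : ∀ t, ∃ d ∈ p.support, d t = p.degreeOf t := fun t => by
    obtain ⟨d, hd, hdt⟩ := Finset.exists_mem_eq_sup p.support
      (MvPolynomial.support_nonempty.2 hp) (fun d => d t)
    exact ⟨d, hd, by rw [MvPolynomial.degreeOf_eq_sup, hdt]⟩
  choose d hd hdt using hex
  have hev : ∀ t, ∀ᶠ q in 𝓝 p, q.coeff (d t) ≠ 0 := fun t =>
    (continuous_coeff (d t)).continuousAt.eventually_ne (MvPolynomial.mem_support_iff.1 (hd t))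
  filter_upwards [Filter.eventually_all.2 hev] with q hq hbox
  refine funext fun t => le_antisymm (mem_boxPoly.1 hbox t) ?_
  show p.degreeOf t ≤ q.degreeOf t
  rw [← hdt t]
  exact MvPolynomial.degreeOf_le_iff.1 le_rfl _ (MvPolynomial.mem_support_iff.2 (hq t))

/-- An irreducible polynomial is not a limit of products of prescribed multidegrees. -/
theorem exists_pNorm_sub_mul_ge {p : MvPolynomial (Fin ℓ) ℂ} (hp : Irreducible p)
    {d₁ d₂ : Fin ℓ → ℕ} (h₁ : d₁ ≠ 0) (h₂ : d₂ ≠ 0) (hd : d₁ + d₂ = multideg p) :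
    ∃ ρ > 0, ∀ a b : MvPolynomial (Fin ℓ) ℂ, a ≠ 0 → b ≠ 0 → multideg a = d₁ → multideg b = d₂ →
      ρ ≤ pNorm (p - a * b) := by
  obtain ⟨ρ, hρ, hmem⟩ := exists_approx_mem_of_isCompact
    ((isCompact_boxSphere d₁).prod (isCompact_boxSphere d₂))
    (Ψ := fun y => y.1 * y.2) (continuous_fst.mul continuous_snd)
    (fun y hy => mul_ne_zero (ne_zero_of_mem_boxSphere hy.1) (ne_zero_of_mem_boxSphere hy.2))
    p (O := ∅) isOpen_empty (by
      rintro γ ⟨a, b⟩ ⟨ha, hb⟩ heq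
      simp only at ha hb heq
      have ha0 := ne_zero_of_mem_boxSphere ha
      have hb0 := ne_zero_of_mem_boxSphere hb
      have hγ : γ ≠ 0 := by
        rintro rfl
        exact hp.ne_zero (heq.trans (zero_smul _ _))
      have hsum : ∀ t, a.degreeOf t + b.degreeOf t = d₁ t + d₂ t := fun t => by
        have := congrFun hd t
        rw [heq, multideg_smul hγ, multideg_mul ha0 hb0] at this
        exact this.symm
      have hda : ∀ t, a.degreeOf t = d₁ t := fun t => by
        have := hsum t; have := ha.1 t; have := hb.1 t; omega
      have hdb : ∀ t, b.degreeOf t = d₂ t := fun t => by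
        have := hsum t; have := ha.1 t; have := hb.1 t; omega
      rw [← smul_mul_assoc] at heq
      rcases hp.isUnit_or_isUnit heq with hu | hu
      · refine h₁ (funext fun t => ?_)
        rw [← hda, ← degreeOf_smul_eq hγ]
        exact degreeOf_eq_zero_of_isUnit hu t
      · refine h₂ (funext fun t => ?_)
        rw [← hdb]
        exact degreeOf_eq_zero_of_isUnit hu t)
  refine ⟨ρ, hρ, fun a b ha hb had hbd => le_of_not_gt fun hlt => ?_⟩
  obtain ⟨c, -, a', ha', rfl⟩ := exists_smul_mem_boxSphere ha fun t => (congrFun had t).le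
  obtain ⟨c', -, b', hb', rfl⟩ := exists_smul_mem_boxSphere hb fun t => (congrFun hbd t).le
  refine hmem (c * c') (a', b') ⟨ha', hb'⟩ ?_
  rwa [← smul_mul_smul_comm]

/-- Small perturbations that do not raise the degrees keep irreducibility. -/
theorem eventually_irreducible {p : MvPolynomial (Fin ℓ) ℂ} (hp : Irreducible p) :
    ∀ᶠ q in 𝓝 p, q ∈ boxPoly (multideg p) → Irreducible q := by
  have hev : ∀ d ∈ Finset.Iic (multideg p), d ≠ 0 → multideg p - d ≠ 0 →
      ∀ᶠ q in 𝓝 p, ∀ a b : MvPolynomial (Fin ℓ) ℂ, a ≠ 0 → b ≠ 0 → multideg a = d →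
        multideg b = multideg p - d → q ≠ a * b := by
    intro d hd h₁ h₂
    obtain ⟨ρ, hρ, hge⟩ := exists_pNorm_sub_mul_ge hp h₁ h₂
      (add_tsub_cancel_of_le (Finset.mem_Iic.1 hd))
    filter_upwards [Metric.ball_mem_nhds p hρ] with q hq a b ha hb had hbd heq
    refine absurd (hge a b ha hb had hbd) (not_le.2 ?_)
    rw [← heq, pNorm_sub_comm]
    rw [mem_ball_iff_norm] at hq
    exact (pNorm_le_l1Norm _).trans_lt hq
  have hev' := (Filter.eventually_all_finset (Finset.Iic (multideg p))).2 fun d hd =>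
    Filter.eventually_imp_distrib_left.2 fun h₁ => Filter.eventually_imp_distrib_left.2 fun h₂ =>
      hev d hd h₁ h₂
  filter_upwards [hev', eventually_multideg_eq hp.ne_zero] with q hq hdeg hbox
  have hqd := hdeg hbox
  have hq0 : multideg q ≠ 0 := hqd ▸ multideg_ne_zero_of_irreducible hp
  have hqne : q ≠ 0 := by
    rintro rfl
    exact hq0 (funext fun t => MvPolynomial.degreeOf_zero t)
  refine ⟨fun hu => hq0 (funext fun t => degreeOf_eq_zero_of_isUnit hu t), fun a b heq => ?_⟩
  by_contra hno
  push Not at hno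
  rw [heq] at hqne
  have ha := left_ne_zero_of_mul hqne
  have hb := right_ne_zero_of_mul hqne
  rw [heq, multideg_mul ha hb] at hqd
  have hbd : multideg b = multideg p - multideg a := by
    rw [← hqd, add_tsub_cancel_left]
  refine hq (multideg a) (Finset.mem_Iic.2 fun t => ?_) (fun h => hno.1 ?_) (fun h => hno.2 ?_)
    a b ha hb rfl hbd heq
  · rw [← hqd]
    exact Nat.le_add_right _ _
  · exact isUnit_of_degreeOf_eq_zero ha fun t => congrFun h t
  · exact isUnit_of_degreeOf_eq_zero hb fun t => congrFun (hbd.trans h) t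

theorem linearIndependent_of_not_associated {p q : MvPolynomial (Fin ℓ) ℂ} (hp : p ≠ 0)
    (hq : q ≠ 0) (h : ¬ Associated p q) : LinearIndependent ℂ ![p, q] := by
  rw [LinearIndependent.pair_iff' hp]
  rintro c rfl
  refine h (associated_smul ?_ p)
  rintro rfl
  exact hq (zero_smul _ _)

theorem not_associated_of_linearIndependent {p q : MvPolynomial (Fin ℓ) ℂ}
    (h : LinearIndependent ℂ ![p, q]) : ¬ Associated p q := fun ha => by
  obtain ⟨c, -, hpq⟩ := exists_smul_of_associated ha.symm
  exact (LinearIndependent.pair_iff' (h.ne_zero 0)).1 h c hpq.symm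

theorem eventually_not_associated {ι : Type*} {p : ι → MvPolynomial (Fin ℓ) ℂ} {i j : ι}
    (hi : p i ≠ 0) (hj : p j ≠ 0) (h : ¬ Associated (p i) (p j)) :
    ∀ᶠ q in 𝓝 p, ¬ Associated (q i) (q j) := by
  have hcont : Continuous fun q : ι → MvPolynomial (Fin ℓ) ℂ => ![q i, q j] := by fun_prop
  have hopen := (isOpen_setOfPred_linearIndependent (𝕜 := ℂ) (ι := Fin 2)
    (E := MvPolynomial (Fin ℓ) ℂ)).preimage hcont
  filter_upwards [hopen.mem_nhds (linearIndependent_of_not_associated hi hj h)] with q hq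
  exact not_associated_of_linearIndependent hq

/-- Irreducibility, non-association and multidegrees of a family of factors are stable under small
perturbations that do not raise the degrees. -/
theorem eventually_irreducible_factors {s : ℕ} {p : Fin s → MvPolynomial (Fin ℓ) ℂ}
    (hp : ∀ i, Irreducible (p i)) (hpa : ∀ i j, i ≠ j → ¬ Associated (p i) (p j)) :
    ∀ᶠ q in 𝓝 p, (∀ i, q i ∈ boxPoly (multideg (p i))) →
      (∀ i, Irreducible (q i)) ∧ (∀ i, multideg (q i) = multideg (p i)) ∧
      ∀ i j, i ≠ j → ¬ Associated (q i) (q j) := by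
  have h1 : ∀ i, ∀ᶠ q in 𝓝 p, q i ∈ boxPoly (multideg (p i)) → Irreducible (q i) := fun i =>
    (continuous_apply i).continuousAt.eventually (eventually_irreducible (hp i))
  have h2 : ∀ i, ∀ᶠ q in 𝓝 p, q i ∈ boxPoly (multideg (p i)) → multideg (q i) = multideg (p i) :=
    fun i => (continuous_apply i).continuousAt.eventually (eventually_multideg_eq (hp i).ne_zero)
  have h3 : ∀ i j, ∀ᶠ q in 𝓝 p, i ≠ j → ¬ Associated (q i) (q j) := fun i j =>
    Filter.eventually_imp_distrib_left.2 fun hij =>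
      eventually_not_associated (hp i).ne_zero (hp j).ne_zero (hpa i j hij)
  filter_upwards [Filter.eventually_all.2 h1, Filter.eventually_all.2 h2,
    Filter.eventually_all.2 fun i => Filter.eventually_all.2 (h3 i)] with q hq1 hq2 hq3 hbox
  exact ⟨fun i => hq1 i (hbox i), fun i => hq2 i (hbox i), hq3⟩

end Openness

section Parametrization

variable {ℓ : ℕ}

attribute [local instance] l1NormedCommRing l1NormedAlgebra
attribute [local instance] l1UniformSpace

theorem pNorm_smul_inv {p : MvPolynomial (Fin ℓ) ℂ} (hp : p ≠ 0) :
    pNorm ((pNorm p : ℂ)⁻¹ • p) = 1 := by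
  rw [pNorm_smul, norm_inv, Complex.norm_real, Real.norm_of_nonneg (pNorm_nonneg p),
    inv_mul_cancel₀ (pNorm_pos hp).ne']

/-- The polynomials of multidegree at most that of `p` which are orthogonal to `p`. -/
noncomputable def orthBox (p : MvPolynomial (Fin ℓ) ℂ) : Submodule ℂ (MvPolynomial (Fin ℓ) ℂ) :=
  boxPoly (multideg p) ⊓ LinearMap.ker (innerₛₗ ℂ (toL2 ℓ p) ∘ₗ toL2 ℓ)

theorem mem_orthBox {p h : MvPolynomial (Fin ℓ) ℂ} :
    h ∈ orthBox p ↔ h ∈ boxPoly (multideg p) ∧ pInner p h = 0 := Iff.rfl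

instance (p : MvPolynomial (Fin ℓ) ℂ) : FiniteDimensional ℂ (orthBox p) :=
  Submodule.finiteDimensional_of_le (S₂ := boxPoly (multideg p)) inf_le_left

theorem eq_zero_of_dvd_of_mem_orthBox {p h : MvPolynomial (Fin ℓ) ℂ} (hp1 : pNorm p = 1)
    (hh : h ∈ orthBox p) (hdvd : p ∣ h) : h = 0 := by
  by_contra h0
  obtain ⟨u, rfl⟩ := hdvd
  have hu : IsUnit u := isUnit_of_degreeOf_eq_zero (right_ne_zero_of_mul h0) fun t => by
    have h1 := mem_boxPoly.1 hh.1 t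
    rw [MvPolynomial.degreeOf_mul_eq (left_ne_zero_of_mul h0) (right_ne_zero_of_mul h0)] at h1
    have : multideg p t = p.degreeOf t := rfl
    omega
  obtain ⟨c, hc, hcp⟩ := exists_smul_of_associated (associated_mul_unit_left p u hu)
  have h2 := (mem_orthBox.1 hh).2
  rw [hcp, pInner_smul_right, pInner_self_of_pNorm_eq_one hp1, mul_one] at h2
  exact hc h2

/-- The differential of the factorization map, restricted to perturbations orthogonal to the
factors, is injective. -/
theorem eq_zero_of_linearized_factorization {s : ℕ} {p h : Fin s → MvPolynomial (Fin ℓ) ℂ}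
    {n : Fin s → ℕ} {a : ℂ} (hp : ∀ i, Irreducible (p i))
    (hpa : ∀ i j, i ≠ j → ¬ Associated (p i) (p j)) (hn : ∀ i, 1 ≤ n i)
    (hp1 : ∀ i, pNorm (p i) = 1) (hh : ∀ i, h i ∈ orthBox (p i))
    (heq : a • ∏ i, p i ^ n i +
      ∑ i, (∏ j ∈ Finset.univ.erase i, p j ^ n j) * (n i * p i ^ (n i - 1) * h i) = 0) :
    a = 0 ∧ ∀ i, h i = 0 := by
  have hz : ∀ i, h i = 0 := fun i => by
    refine eq_zero_of_dvd_of_mem_orthBox (hp1 i) (hh i) ?_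
    have hprime := (hp i).prime
    have hdvd : p i ^ n i ∣
        (∏ j ∈ Finset.univ.erase i, p j ^ n j) * (n i * p i ^ (n i - 1) * h i) := by
      rw [← Finset.add_sum_erase _ _ (Finset.mem_univ i), add_left_comm] at heq
      rw [eq_neg_of_add_eq_zero_left heq, dvd_neg]
      refine dvd_add ?_ (Finset.dvd_sum fun j hj => Dvd.dvd.mul_right ?_ _)
      · rw [MvPolynomial.smul_eq_C_mul]
        exact (Finset.dvd_prod_of_mem (fun i => p i ^ n i) (Finset.mem_univ i)).mul_left _
      · exact Finset.dvd_prod_of_mem (fun i => p i ^ n i)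
          (Finset.mem_erase.2 ⟨(Finset.ne_of_mem_erase hj).symm, Finset.mem_univ i⟩)
    have hpow : p i ^ n i = p i ^ (n i - 1) * p i := by
      rw [← pow_succ, Nat.sub_add_cancel (hn i)]
    have hre : (∏ j ∈ Finset.univ.erase i, p j ^ n j) * (n i * p i ^ (n i - 1) * h i) =
        p i ^ (n i - 1) * ((∏ j ∈ Finset.univ.erase i, p j ^ n j) * (n i * h i)) := by ring
    rw [hre, hpow] at hdvd
    rcases hprime.dvd_or_dvd ((mul_dvd_mul_iff_left (pow_ne_zero _ (hp i).ne_zero)).1 hdvd) with h1 | h1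
    · obtain ⟨j, hj, hij⟩ := (hprime.dvd_finsetProd_iff _).1 h1
      exact absurd ((hp i).associated_of_dvd (hp j) (hprime.dvd_of_dvd_pow hij))
        (hpa i j (Finset.ne_of_mem_erase hj).symm)
    · refine (hprime.dvd_or_dvd h1).resolve_left fun h2 => (hp i).not_isUnit ?_
      refine isUnit_of_dvd_unit h2 ?_
      rw [← map_natCast (MvPolynomial.C (σ := Fin ℓ) (R := ℂ))]
      exact (IsUnit.mk0 (n i : ℂ) (Nat.cast_ne_zero.2 (Nat.one_le_iff_ne_zero.1 (hn i)))).map _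
  refine ⟨?_, hz⟩
  simp only [hz, mul_zero, Finset.sum_const_zero, add_zero] at heq
  exact (smul_eq_zero.1 heq).resolve_right (prod_pow_ne_zero (fun i => (hp i).ne_zero) n)

/-- Local parametrization of a factorization manifold: the leading scalar is perturbed
multiplicatively and each factor `p i` in directions orthogonal to itself. -/
noncomputable def factorMap {s : ℕ} (α : ℂ) (p : Fin s → MvPolynomial (Fin ℓ) ℂ) (n : Fin s → ℕ)
    (x : ℂ × ((i : Fin s) → orthBox (p i))) : MvPolynomial (Fin ℓ) ℂ :=
  ((1 + x.1) * α) • ∏ i, (p i + x.2 i) ^ n i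

theorem contDiff_factorMap {s : ℕ} (α : ℂ) (p : Fin s → MvPolynomial (Fin ℓ) ℂ) (n : Fin s → ℕ) :
    ContDiff ℂ 2 (factorMap α p n) := by
  have hcoe : ∀ i, ContDiff ℂ 2
      fun x : ℂ × ((i : Fin s) → orthBox (p i)) => (x.2 i : MvPolynomial (Fin ℓ) ℂ) := fun i =>
    (((orthBox (p i)).subtypeL.comp (ContinuousLinearMap.proj i)).comp
      (ContinuousLinearMap.snd ℂ ℂ ((i : Fin s) → orthBox (p i)))).contDiff
  refine ContDiff.smul (f := fun x : ℂ × ((i : Fin s) → orthBox (p i)) => (1 + x.1) * α)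
    (by fun_prop) (contDiff_prod fun i _ => ?_)
  exact (contDiff_const.add (hcoe i)).pow _

theorem injective_fderiv_factorMap {s : ℕ} {α : ℂ} {p : Fin s → MvPolynomial (Fin ℓ) ℂ}
    {n : Fin s → ℕ} (hα : α ≠ 0) (hp : ∀ i, Irreducible (p i))
    (hpa : ∀ i j, i ≠ j → ¬ Associated (p i) (p j)) (hn : ∀ i, 1 ≤ n i)
    (hp1 : ∀ i, pNorm (p i) = 1) :
    Function.Injective (fderiv ℂ (factorMap α p n) 0) := by
  rw [injective_iff_map_eq_zero]
  rintro ⟨a, h⟩ hv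
  have hd : HasFDerivAt (factorMap α p n) (fderiv ℂ (factorMap α p n) 0) ((0 : ℂ) • (a, h)) := by
    rw [zero_smul]
    exact ((contDiff_factorMap α p n).differentiable two_ne_zero 0).hasFDerivAt
  have h1 := hd.comp_hasDerivAt (0 : ℂ) ((hasDerivAt_id (0 : ℂ)).smul_const (a, h))
  rw [one_smul, hv] at h1
  have hlin : ∀ i, HasDerivAt (fun z : ℂ => p i + z • (h i : MvPolynomial (Fin ℓ) ℂ)) (h i) 0 :=
    fun i => by
      simpa using ((hasDerivAt_id (0 : ℂ)).smul_const (h i : MvPolynomial (Fin ℓ) ℂ)).const_add (p i)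
  have hscal : HasDerivAt (fun z : ℂ => (1 + z * a) * α) (a * α) 0 := by
    simpa using (((hasDerivAt_id (0 : ℂ)).mul_const a).const_add 1).mul_const α
  have h2 := hscal.fun_smul (HasDerivAt.fun_finsetProd (u := Finset.univ)
    fun i _ => (hlin i).fun_pow (n i))
  have h3 := h1.unique h2
  simp only [zero_smul, zero_mul, add_zero, one_mul, smul_eq_mul] at h3
  have h4 := eq_zero_of_linearized_factorization hp hpa hn hp1 (a := a) (fun i => (h i).2) (by
    refine (smul_eq_zero_iff_right hα).1 ?_
    rw [smul_add, smul_smul, mul_comm α a, add_comm]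
    exact h3.symm)
  exact Prod.ext h4.1 (funext fun i => Subtype.ext (h4.2 i))

end Parametrization

section NearestPoint

/-- Complex version of the Lipschitz continuity of local nearest points. -/
theorem exists_lipschitz_nearest_point_complex {X V : Type*} [NormedAddCommGroup X]
    [NormedSpace ℂ X] [FiniteDimensional ℂ X] [NormedAddCommGroup V] [InnerProductSpace ℂ V]
    {Φ : X → V} (hΦ : ContDiff ℂ 2 Φ) (x₀ : X) (hinj : Function.Injective (fderiv ℂ Φ x₀)) :
    ∃ η > 0, ∃ ρ > 0, ∃ L ≥ 0, ∀ (f f' : V) (x x' : X), ‖x - x₀‖ < η → ‖x' - x₀‖ < η →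
      ‖f' - Φ x'‖ ≤ ρ → IsLocalMin (fun y => ‖f - Φ y‖) x →
      IsLocalMin (fun y => ‖f' - Φ y‖) x' → ‖x - x'‖ ≤ L * ‖f - f'‖ := by
  let _ : InnerProductSpace ℝ V := InnerProductSpace.complexToReal
  have hfd : fderiv ℝ Φ x₀ = (fderiv ℂ Φ x₀).restrictScalars ℝ :=
    (((hΦ.differentiable two_ne_zero) x₀).hasFDerivAt.restrictScalars ℝ).fderiv
  refine exists_lipschitz_nearest_point (hΦ.restrict_scalars ℝ) x₀ ?_
  rw [hfd]
  exact hinj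

variable {ℓ : ℕ}

attribute [local instance] l1NormedCommRing l1NormedAlgebra
attribute [local instance] l1UniformSpace

/-- Local nearest points of a factorization manifold depend Lipschitz continuously on the data. -/
theorem exists_lipschitz_factorMap {s : ℕ} {α : ℂ} {p : Fin s → MvPolynomial (Fin ℓ) ℂ}
    {n : Fin s → ℕ} (hα : α ≠ 0) (hp : ∀ i, Irreducible (p i))
    (hpa : ∀ i j, i ≠ j → ¬ Associated (p i) (p j)) (hn : ∀ i, 1 ≤ n i)
    (hp1 : ∀ i, pNorm (p i) = 1) :
    ∃ η > 0, ∃ ρ > 0, ∃ L ≥ 0, ∀ (f f' : MvPolynomial (Fin ℓ) ℂ)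
      (x x' : ℂ × ((i : Fin s) → orthBox (p i))), ‖x‖ < η → ‖x'‖ < η →
      pNorm (f' - factorMap α p n x') ≤ ρ →
      IsLocalMin (fun y => pNorm (f - factorMap α p n y)) x →
      IsLocalMin (fun y => pNorm (f' - factorMap α p n y)) x' →
      ‖x - x'‖ ≤ L * pNorm (f - f') := by
  have hΦ : ContDiff ℂ 2 fun x => toL2CLM ℓ (factorMap α p n x) :=
    (toL2CLM ℓ).contDiff.comp (contDiff_factorMap α p n)
  have hfd : fderiv ℂ (fun x => toL2CLM ℓ (factorMap α p n x)) 0 =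
      (toL2CLM ℓ).comp (fderiv ℂ (factorMap α p n) 0) :=
    ((toL2CLM ℓ).hasFDerivAt.comp 0
      ((contDiff_factorMap α p n).differentiable two_ne_zero 0).hasFDerivAt).fderiv
  obtain ⟨η, hη, ρ, hρ, L, hL, h⟩ := exists_lipschitz_nearest_point_complex hΦ 0 (by
    rw [hfd]
    exact toL2_injective.comp (injective_fderiv_factorMap hα hp hpa hn hp1))
  refine ⟨η, hη, ρ, hρ, L, hL, fun f f' x x' hx hx' hf' hmin hmin' => ?_⟩
  exact h (toL2 ℓ f) (toL2 ℓ f') x x' (by rwa [sub_zero]) (by rwa [sub_zero]) hf' hmin hmin'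

end NearestPoint

section FactorizationDistance

variable {ℓ : ℕ}

theorem psin_nonneg (p q : MvPolynomial (Fin ℓ) ℂ) : 0 ≤ psin p q := by
  unfold psin
  split_ifs
  exacts [le_rfl, zero_le_one, zero_le_one, pNorm_nonneg _]

/-- The sine of the angle between `p` and `q` is the normalised distance of `p` to the line of `q`. -/
theorem psin_mul_pNorm_le {p q : MvPolynomial (Fin ℓ) ℂ} (hp : p ≠ 0) (hq : q ≠ 0) (c : ℂ) :
    psin p q * pNorm p ≤ pNorm (p - c • q) := by
  have hp' : (pNorm p : ℂ) ≠ 0 := Complex.ofReal_ne_zero.2 (pNorm_pos hp).ne'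
  have hq' : (pNorm q : ℂ) ≠ 0 := Complex.ofReal_ne_zero.2 (pNorm_pos hq).ne'
  set b : ℂ := pInner q p / (pNorm q : ℂ) ^ 2 with hb
  have hsin : psin p q * pNorm p = pNorm (p - b • q) := by
    have hre : (pNorm p : ℂ)⁻¹ • p - (pInner q p / ((pNorm q : ℂ) * (pNorm p : ℂ))) •
        ((pNorm q : ℂ)⁻¹ • q) = (pNorm p : ℂ)⁻¹ • (p - b • q) := by
      rw [smul_sub, smul_smul, smul_smul]
      congr 2
      rw [hb]
      field_simp
    rw [psin, if_neg hp, if_neg hq, hre, pNorm_smul, norm_inv, Complex.norm_real,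
      Real.norm_of_nonneg (pNorm_nonneg p), mul_comm, mul_inv_cancel_left₀ (pNorm_pos hp).ne']
  have horth : inner ℂ (toL2 ℓ ((b - c) • q)) (toL2 ℓ (p - b • q)) = 0 := by
    have hqq : pInner q q = (pNorm q : ℂ) ^ 2 := by
      rw [← inner_toL2, inner_self_eq_norm_sq_to_K, norm_toL2]
      rfl
    rw [map_smul, map_sub, map_smul, inner_smul_left, inner_sub_right, inner_smul_right,
      inner_toL2, inner_toL2, hqq, hb, div_mul_cancel₀ _ (pow_ne_zero 2 hq'), sub_self, mul_zero]
  have hpyth := norm_add_sq_eq_norm_sq_add_norm_sq_of_inner_eq_zero _ _ horth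
  have hadd : (b - c) • q + (p - b • q) = p - c • q := by
    rw [sub_smul]
    abel
  rw [← map_add, hadd, norm_toL2, norm_toL2, norm_toL2] at hpyth
  rw [hsin]
  refine le_of_sq_le_sq ?_ (pNorm_nonneg _)
  nlinarith [mul_self_nonneg (pNorm ((b - c) • q))]

theorem factDistL_nonneg (l₁ l₂ : List (MvPolynomial (Fin ℓ) ℂ)) : 0 ≤ factDistL l₁ l₂ := by
  unfold factDistL
  split_ifs with h h0
  · refine Finset.le_inf' _ _ fun σ _ => ?_
    exact (psin_nonneg _ _).trans (Finset.le_sup' (fun j => psin (l₁.get j)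
      (l₂.get (Fin.cast h (σ j)))) (Finset.mem_univ ⟨0, h0⟩))
  · exact le_rfl
  · exact zero_le_one

theorem factDistL_map_le {ι ι' : Type*} {T : List ι} {T' : List ι'} {e : ι → ι'}
    (hperm : (T.map e).Perm T') {fs : ι → MvPolynomial (Fin ℓ) ℂ}
    {fs' : ι' → MvPolynomial (Fin ℓ) ℂ} {B : ℝ} (hB : 0 ≤ B)
    (hle : ∀ j, psin (fs j) (fs' (e j)) ≤ B) : factDistL (T.map fs) (T'.map fs') ≤ B := by
  have hlen : (T.map fs).length = (T'.map fs').length := by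
    simpa using hperm.length_eq
  have hlen₁ : (T.map fs).length = (T.map e).length := by simp
  have hlen₂ : T'.length = (T.map fs).length := by simp [hlen]
  unfold factDistL
  rw [dif_pos hlen]
  split_ifs with h0
  · let g : Fin (T.map fs).length → Fin (T.map fs).length := fun j =>
      Fin.cast hlen₂ (hperm.idxBij (Fin.cast hlen₁ j))
    have hg : Function.Injective g := fun i j hij =>
      Fin.cast_injective _ (hperm.idxBij_injective (Fin.cast_injective _ hij))
    refine (Finset.inf'_le _ (Finset.mem_univ
      (Equiv.ofBijective g (Finite.injective_iff_bijective.1 hg)))).trans ?_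
    refine Finset.sup'_le _ _ fun j _ => ?_
    have hget := hperm.getElem_idxBij_eq_getElem (Fin.cast hlen₁ j)
    simp only [List.get_eq_getElem, List.getElem_map, Equiv.ofBijective_apply, Fin.val_cast, g] at hget ⊢
    rw [hget]
    exact hle _
  · exact hB

/-- The list of indices, each repeated according to its multiplicity. -/
def indexList {r : ℕ} (ks : Fin r → ℕ) : List (Fin r) :=
  (List.ofFn fun j => List.replicate (ks j) j).flatten

theorem fullList_eq_map_indexList {r : ℕ} (fs : Fin r → MvPolynomial (Fin ℓ) ℂ) (ks : Fin r → ℕ) :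
    fullList r fs ks = (indexList ks).map fs := by
  rw [fullList, indexList, List.map_flatten, List.map_ofFn]
  simp [Function.comp_def]

theorem count_indexList {r : ℕ} (ks : Fin r → ℕ) (j : Fin r) :
    (indexList ks).count j = ks j := by
  rw [indexList, List.count_flatten, List.map_ofFn, List.sum_ofFn]
  simp [List.count_replicate]

theorem map_indexList_perm {r r' : ℕ} {ks : Fin r → ℕ} {ks' : Fin r' → ℕ} (e : Fin r ≃ Fin r')
    (hk : ∀ j, ks j = ks' (e j)) : ((indexList ks).map e).Perm (indexList ks') := by
  rw [List.perm_iff_count]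
  intro j
  obtain ⟨i, rfl⟩ := e.surjective j
  rw [List.count_map_of_injective _ _ e.injective, count_indexList, count_indexList, hk]

theorem factDistL_fullList_le {r r' : ℕ} {fs : Fin r → MvPolynomial (Fin ℓ) ℂ}
    {fs' : Fin r' → MvPolynomial (Fin ℓ) ℂ} {ks : Fin r → ℕ} {ks' : Fin r' → ℕ}
    (e : Fin r ≃ Fin r') (hk : ∀ j, ks j = ks' (e j)) {B : ℝ} (hB : 0 ≤ B)
    (hle : ∀ j, psin (fs j) (fs' (e j)) ≤ B) :
    factDistL (fullList r fs ks) (fullList r' fs' ks') ≤ B := by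
  rw [fullList_eq_map_indexList, fullList_eq_map_indexList]
  exact factDistL_map_le (map_indexList_perm e hk) hB hle

end FactorizationDistance

section LocalStructure

open scoped Topology

variable {ℓ : ℕ} {m : Fin ℓ → ℕ} {s : ℕ} {α : ℂ} {p : Fin s → MvPolynomial (Fin ℓ) ℂ} {n : Fin s → ℕ}

attribute [local instance] l1NormedCommRing l1NormedAlgebra
attribute [local instance] l1UniformSpace

/-- `α ∏ pᵢ ^ nᵢ` is an irreducible factorization of multidegree `m` with unit factors `pᵢ`. -/
structure IsUnitFactorization (m : Fin ℓ → ℕ) {s : ℕ} (α : ℂ)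
    (p : Fin s → MvPolynomial (Fin ℓ) ℂ) (n : Fin s → ℕ) : Prop where
  scalar_ne_zero : α ≠ 0
  irreducible : ∀ i, Irreducible (p i)
  not_associated : ∀ i j, i ≠ j → ¬ Associated (p i) (p j)
  isStruct : IsStruct m s (fun i => multideg (p i)) n
  pNorm_eq_one : ∀ i, pNorm (p i) = 1

theorem exists_isUnitFactorization {mdeg : Fin s → Fin ℓ → ℕ} (hS : IsStruct m s mdeg n)
    {f : MvPolynomial (Fin ℓ) ℂ} (hf : f ∈ FMset s mdeg n) :
    ∃ (α : ℂ) (p : Fin s → MvPolynomial (Fin ℓ) ℂ), IsUnitFactorization m α p n ∧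
      mdeg = (fun i => multideg (p i)) ∧ f = α • ∏ i, p i ^ n i := by
  obtain ⟨β, g, hβ, hg, hgd, hga, rfl⟩ := hf
  have hc : ∀ i, (pNorm (g i) : ℂ) ≠ 0 := fun i =>
    Complex.ofReal_ne_zero.2 (pNorm_pos (hg i).ne_zero).ne'
  have hassoc : ∀ i, Associated (g i) ((pNorm (g i) : ℂ)⁻¹ • g i) := fun i =>
    associated_smul (inv_ne_zero (hc i)) (g i)
  have hdeg : mdeg = fun i => multideg ((pNorm (g i) : ℂ)⁻¹ • g i) := funext fun i => by
    rw [multideg_smul (inv_ne_zero (hc i))]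
    exact (funext (hgd i)).symm
  refine ⟨β * ∏ i, (pNorm (g i) : ℂ) ^ n i, fun i => (pNorm (g i) : ℂ)⁻¹ • g i,
    ⟨mul_ne_zero hβ (Finset.prod_ne_zero_iff.2 fun i _ => pow_ne_zero _ (hc i)),
      fun i => (hassoc i).irreducible (hg i),
      fun i j hij h => hga i j hij ((hassoc i).trans (h.trans (hassoc j).symm)),
      hdeg ▸ hS, fun i => pNorm_smul_inv (hg i).ne_zero⟩, hdeg, ?_⟩
  rw [mul_smul, ← prod_smul_pow, MvPolynomial.smul_eq_C_mul]
  simp only [smul_inv_smul₀ (hc _)]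

theorem smul_prod_mem_FMset {q : Fin s → MvPolynomial (Fin ℓ) ℂ} (hq : ∀ i, Irreducible (q i))
    (hqd : ∀ i, multideg (q i) = multideg (p i))
    (hqa : ∀ i j, i ≠ j → ¬ Associated (q i) (q j)) {γ : ℂ} (hγ : γ ≠ 0) :
    γ • ∏ i, q i ^ n i ∈ FMset s (fun i => multideg (p i)) n :=
  ⟨γ, q, hγ, hq, fun i t => congrFun (hqd i) t, hqa, MvPolynomial.smul_eq_C_mul _ _⟩

theorem factorMap_zero : factorMap α p n 0 = α • ∏ i, p i ^ n i := by
  simp [factorMap]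

theorem norm_factor_le (x : ℂ × ((i : Fin s) → orthBox (p i))) (i : Fin s) :
    ‖(x.2 i : MvPolynomial (Fin ℓ) ℂ)‖ ≤ ‖x‖ :=
  (norm_le_pi_norm x.2 i).trans (norm_snd_le x)

theorem add_mem_boxPoly (x : ℂ × ((i : Fin s) → orthBox (p i))) (i : Fin s) :
    p i + x.2 i ∈ boxPoly (multideg (p i)) :=
  Submodule.add_mem _ (mem_boxPoly.2 fun _ => le_rfl) (mem_orthBox.1 (x.2 i).2).1

namespace IsUnitFactorization

/-- The parametrization stays in the factorization manifold near the origin. -/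
theorem exists_factors_stable (H : IsUnitFactorization m α p n) :
    ∃ η > 0, ∀ x : ℂ × ((i : Fin s) → orthBox (p i)), ‖x‖ < η →
      (1 + x.1) * α ≠ 0 ∧ (∀ i, Irreducible (p i + (x.2 i : MvPolynomial (Fin ℓ) ℂ))) ∧
      (∀ i, multideg (p i + (x.2 i : MvPolynomial (Fin ℓ) ℂ)) = multideg (p i)) ∧
      ∀ i j, i ≠ j → ¬ Associated (p i + (x.2 i : MvPolynomial (Fin ℓ) ℂ))
        (p j + (x.2 j : MvPolynomial (Fin ℓ) ℂ)) := by
  obtain ⟨η, hη, hball⟩ := Metric.eventually_nhds_iff.1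
    (eventually_irreducible_factors H.irreducible H.not_associated)
  refine ⟨min η 1, lt_min hη one_pos, fun x hx => ⟨mul_ne_zero (fun h => ?_) H.scalar_ne_zero, ?_⟩⟩
  · have h1 : x.1 = -1 := by linear_combination h
    have h2 := norm_fst_le x
    rw [h1, norm_neg, norm_one] at h2
    exact absurd (hx.trans_le (min_le_right _ _)) (not_lt.2 h2)
  · refine hball (y := fun i => p i + x.2 i) ?_ (add_mem_boxPoly x)
    rw [dist_pi_lt_iff hη]
    intro i
    rw [dist_eq_norm, add_sub_cancel_left]
    exact (norm_factor_le x i).trans_lt (hx.trans_le (min_le_left _ _))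

/-- Points of the factorization manifold close to `α ∏ pᵢ ^ nᵢ` are in the image of a small ball
under the parametrization. -/
theorem exists_factorMap_eq (H : IsUnitFactorization m α p n) {η : ℝ} (hη : 0 < η) :
    ∃ ρ > 0, ∀ (γ : ℂ) (F : Fin s → MvPolynomial (Fin ℓ) ℂ), (∀ j, F j ≠ 0) →
      (∀ j, multideg (F j) = multideg (p j)) →
      pNorm (α • ∏ i, p i ^ n i - γ • ∏ j, F j ^ n j) < ρ →
      ∃ (σ : Equiv.Perm (Fin s)) (x : ℂ × ((i : Fin s) → orthBox (p i))), ‖x‖ < η ∧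
        γ • ∏ j, F j ^ n j = factorMap α p n x ∧
        ∀ i, n (σ i) = n i ∧ ∃ c : ℂ, c ≠ 0 ∧ p i + x.2 i = c • F (σ i) := by
  obtain ⟨ρ, hρ, h⟩ := exists_factors_near H.irreducible H.not_associated H.scalar_ne_zero
    H.isStruct H.pNorm_eq_one hη
  refine ⟨ρ, hρ, fun γ F hF hFd hlt => ?_⟩
  obtain ⟨σ, q, a, ha, heq, hq⟩ := h γ F hF hFd hlt
  have hmem : ∀ i, q i - p i ∈ orthBox (p i) := fun i => by
    refine mem_orthBox.2 ⟨Submodule.sub_mem _ (mem_boxPoly.2 fun t => ?_)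
      (mem_boxPoly.2 fun t => le_rfl), ?_⟩
    · exact (congrFun (hq i).2.1 t).le
    · rw [sub_eq_add_neg, pInner_add_right, (hq i).2.2.2.1, ← neg_one_smul ℂ (p i),
        pInner_smul_right, pInner_self_of_pNorm_eq_one (H.pNorm_eq_one i)]
      ring
  refine ⟨σ, (a, fun i => ⟨q i - p i, hmem i⟩), ?_, ?_, fun i => ⟨(hq i).1, ?_⟩⟩
  · rw [Prod.norm_def]
    exact max_lt ha ((pi_norm_lt_iff hη).2 fun i => (hq i).2.2.1)
  · rw [heq, factorMap]
    simp only [add_sub_cancel]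
  · simpa only [add_sub_cancel] using (hq i).2.2.2.2

theorem one_le_pNorm_add (H : IsUnitFactorization m α p n)
    (x : ℂ × ((i : Fin s) → orthBox (p i))) (i : Fin s) :
    1 ≤ pNorm (p i + (x.2 i : MvPolynomial (Fin ℓ) ℂ)) := by
  have h := norm_inner_le_norm (𝕜 := ℂ) (toL2 ℓ (p i)) (toL2 ℓ (p i + (x.2 i : MvPolynomial (Fin ℓ) ℂ)))
  rw [inner_toL2, pInner_add_right, pInner_self_of_pNorm_eq_one (H.pNorm_eq_one i),
    (mem_orthBox.1 (x.2 i).2).2, add_zero, norm_one, norm_toL2, norm_toL2, H.pNorm_eq_one i,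
    one_mul] at h
  exact h

theorem psin_le_norm_sub (H : IsUnitFactorization m α p n)
    {x x' : ℂ × ((i : Fin s) → orthBox (p i))} {i : Fin s}
    {g g' : MvPolynomial (Fin ℓ) ℂ} (hg' : g' ≠ 0) {c c' : ℂ} (hc : c ≠ 0)
    (h : p i + x.2 i = c • g) (h' : p i + x'.2 i = c' • g') : psin g g' ≤ ‖x - x'‖ := by
  have hone := H.one_le_pNorm_add x i
  rw [h, pNorm_smul] at hone
  have hg : g ≠ 0 := by
    rintro rfl
    have h0 : pNorm (0 : MvPolynomial (Fin ℓ) ℂ) = 0 := by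
      rw [← norm_toL2, map_zero, norm_zero]
    rw [h0, mul_zero] at hone
    exact absurd hone (by norm_num)
  have h1 := psin_mul_pNorm_le hg hg' (c⁻¹ * c')
  have h2 : ‖c‖ * pNorm (g - (c⁻¹ * c') • g') = pNorm (x.2 i - x'.2 i : MvPolynomial (Fin ℓ) ℂ) := by
    rw [← pNorm_smul, smul_sub, smul_smul, mul_inv_cancel_left₀ hc, ← h, ← h', add_sub_add_left_eq_sub]
  have h3 : pNorm (x.2 i - x'.2 i : MvPolynomial (Fin ℓ) ℂ) ≤ ‖x - x'‖ :=
    (pNorm_le_l1Norm _).trans (norm_factor_le (x - x') i)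
  have h4 := mul_le_mul_of_nonneg_left h1 (norm_nonneg c)
  calc psin g g' ≤ psin g g' * (‖c‖ * pNorm g) := le_mul_of_one_le_right (psin_nonneg _ _) hone
    _ = ‖c‖ * (psin g g' * pNorm g) := by ring
    _ ≤ ‖x - x'‖ := by linarith

end IsUnitFactorization

end LocalStructure

section WellPosedness

open scoped Topology

variable {ℓ : ℕ} {m : Fin ℓ → ℕ} {s : ℕ} {α : ℂ} {p : Fin s → MvPolynomial (Fin ℓ) ℂ} {n : Fin s → ℕ}

theorem distE_le {S : Set (MvPolynomial (Fin ℓ) ℂ)} {g : MvPolynomial (Fin ℓ) ℂ} (hg : g ∈ S)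
    (f : MvPolynomial (Fin ℓ) ℂ) : distE f S ≤ ENNReal.ofReal (pNorm (f - g)) :=
  iInf₂_le g hg

/-- A manifold within reach of a point near `f₀` has `f₀` in its closure. -/
theorem mem_pclosure_of_distE_lt {f f₀ : MvPolynomial (Fin ℓ) ℂ} {r : ℕ}
    {mdeg : Fin r → Fin ℓ → ℕ} {k : Fin r → ℕ} (hS : IsStruct m r mdeg k) {ε : ℝ}
    (hdist : distE f (FMset r mdeg k) < ENNReal.ofReal ε)
    (hε : ENNReal.ofReal ε < theta m f₀ / 2)
    (hf : ENNReal.ofReal (pNorm (f - f₀)) ≤ theta m f₀ / 2) :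
    f₀ ∈ pclosure (FMset r mdeg k) := by
  by_contra hno
  obtain ⟨g, hg, hlt⟩ : ∃ g ∈ FMset r mdeg k,
      ENNReal.ofReal (pNorm (f - g)) < ENNReal.ofReal ε := by
    simpa only [distE, iInf_lt_iff, exists_prop] using hdist
  have hθ : theta m f₀ ≤ distE f₀ (FMset r mdeg k) :=
    iInf_le_of_le r (iInf_le_of_le mdeg (iInf_le_of_le k (iInf_le_of_le hS (iInf_le _ hno))))
  have htri : ENNReal.ofReal (pNorm (f₀ - g)) ≤
      ENNReal.ofReal (pNorm (f - f₀)) + ENNReal.ofReal (pNorm (f - g)) := by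
    rw [← ENNReal.ofReal_add (pNorm_nonneg _) (pNorm_nonneg _), pNorm_sub_comm f f₀]
    exact ENNReal.ofReal_le_ofReal (pNorm_sub_le _ _ _)
  refine lt_irrefl (theta m f₀) (((hθ.trans (distE_le hg f₀)).trans htri).trans_lt ?_)
  conv_rhs => rw [← ENNReal.add_halves (theta m f₀)]
  exact ENNReal.add_lt_add_of_le_of_lt ENNReal.ofReal_ne_top hf (hlt.trans hε)

theorem exists_pos_ofReal_le (a : ENNReal) : ∃ ρ : ℝ, 0 < ρ ∧ (a ≠ 0 → ENNReal.ofReal ρ ≤ a) := by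
  by_cases ha : a = 0
  · exact ⟨1, one_pos, fun h => absurd ha h⟩
  have htop : min a 1 ≠ ⊤ := ne_top_of_le_ne_top ENNReal.one_ne_top (min_le_right _ _)
  refine ⟨(min a 1).toReal, ENNReal.toReal_pos ?_ htop, fun _ => ?_⟩
  · exact (lt_min (pos_iff_ne_zero.2 ha) one_pos).ne'
  · rw [ENNReal.ofReal_toReal htop]
    exact min_le_left _ _

theorem FMset_subset_of_equiv {r : ℕ} {mdeg : Fin r → Fin ℓ → ℕ} {k : Fin r → ℕ}
    {mdeg' : Fin s → Fin ℓ → ℕ} {k' : Fin s → ℕ} (e : Fin r ≃ Fin s)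
    (h : ∀ j, mdeg j = mdeg' (e j) ∧ k j = k' (e j)) : FMset s mdeg' k' ⊆ FMset r mdeg k := by
  rintro _ ⟨β, g, hβ, hg, hgd, hga, rfl⟩
  refine ⟨β, fun j => g (e j), hβ, fun j => hg _, fun j t => ?_,
    fun i j hij => hga _ _ (e.injective.ne hij), ?_⟩
  · rw [hgd, (h j).1]
  · simp only [(h _).2]
    rw [Equiv.prod_comp e fun i => g i ^ k' i]

namespace IsUnitFactorization

attribute [local instance] l1NormedCommRing l1NormedAlgebra
attribute [local instance] l1UniformSpace

/-- A numerical factorization of a polynomial near `α ∏ pᵢ ^ nᵢ` is given by a small local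
minimizer of the distance in the local parametrization. -/
theorem exists_coordinates_of_isNIF (H : IsUnitFactorization m α p n) {η : ℝ} (hη : 0 < η)
    (hstable : ∀ x : ℂ × ((i : Fin s) → orthBox (p i)), ‖x‖ < η →
      factorMap α p n x ∈ FMset s (fun i => multideg (p i)) n) :
    ∃ ρ > 0, ∀ (f : MvPolynomial (Fin ℓ) ℂ) (ε : ℝ) (β : ℂ) (r : ℕ)
      (fs : Fin r → MvPolynomial (Fin ℓ) ℂ) (ks : Fin r → ℕ),
      pNorm (f - α • ∏ i, p i ^ n i) < ρ →
      ENNReal.ofReal (pNorm (f - α • ∏ i, p i ^ n i)) ≤ theta m (α • ∏ i, p i ^ n i) / 2 →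
      distE f (FMset s (fun i => multideg (p i)) n) < ENNReal.ofReal ε →
      ENNReal.ofReal ε < theta m (α • ∏ i, p i ^ n i) / 2 →
      IsNIF m f ε β r fs ks →
      ∃ (e : Fin r ≃ Fin s) (x : ℂ × ((i : Fin s) → orthBox (p i))), ‖x‖ < η ∧
        (∀ j, ks j = n (e j)) ∧ (∀ j, ∃ c : ℂ, c ≠ 0 ∧ p (e j) + x.2 (e j) = c • fs j) ∧
        IsLocalMin (fun y => pNorm (f - factorMap α p n y)) x ∧
        pNorm (f - factorMap α p n x) ≤ pNorm (f - α • ∏ i, p i ^ n i) := by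
  obtain ⟨ρ, hρ, hnear⟩ := H.exists_factorMap_eq hη
  refine ⟨ρ / 2, half_pos hρ, fun f ε β r fs ks hf hfθ hdist hε hNIF => ?_⟩
  obtain ⟨-, hfs, -, hst, hmax, ⟨γ, -, hγ⟩, hlt⟩ := hNIF
  obtain ⟨e, he⟩ := (codimOf_le_of_mem_pclosure H.irreducible H.not_associated H.scalar_ne_zero
    H.isStruct hst (mem_pclosure_of_distE_lt hst hlt hε hfθ)).2 (hmax _ _ _ H.isStruct hdist)
  have hle : ∀ g ∈ FMset s (fun i => multideg (p i)) n,
      pNorm (f - MvPolynomial.C γ * ∏ j, fs j ^ ks j) ≤ pNorm (f - g) := fun g hg =>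
    (ENNReal.ofReal_le_ofReal_iff (pNorm_nonneg _)).1
      (hγ.trans_le (distE_le (FMset_subset_of_equiv e he hg) f))
  have hprod : MvPolynomial.C γ * ∏ j, fs j ^ ks j = γ • ∏ i, fs (e.symm i) ^ n i := by
    rw [MvPolynomial.smul_eq_C_mul, ← Equiv.prod_comp e]
    simp only [Equiv.symm_apply_apply, (he _).2]
  rw [hprod] at hle
  have hcenter : pNorm (f - γ • ∏ i, fs (e.symm i) ^ n i) ≤ pNorm (f - α • ∏ i, p i ^ n i) := by
    have h := hle _ (hstable 0 (by rwa [norm_zero]))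
    rwa [factorMap_zero] at h
  obtain ⟨σ, x, hx, heq, hσ⟩ := hnear γ (fun i => fs (e.symm i)) (fun i => (hfs _).ne_zero)
    (fun i => (he (e.symm i)).1.trans (by rw [Equiv.apply_symm_apply])) (by
      have := pNorm_sub_le (α • ∏ i, p i ^ n i) f (γ • ∏ i, fs (e.symm i) ^ n i)
      rw [pNorm_sub_comm _ f] at this
      linarith)
  rw [heq] at hle hcenter
  refine ⟨e.trans σ.symm, x, hx, fun j => ?_, fun j => ?_, ?_, hcenter⟩
  · rw [(he j).2, Equiv.trans_apply, ← (hσ (σ.symm (e j))).1, Equiv.apply_symm_apply]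
  · simpa using (hσ (σ.symm (e j))).2
  · filter_upwards [Metric.isOpen_ball.mem_nhds (mem_ball_zero_iff.2 hx)] with y hy
    exact hle _ (hstable y (mem_ball_zero_iff.1 hy))

/-- Numerical factorizations exist near `α ∏ pᵢ ^ nᵢ`. -/
theorem exists_isNIF (H : IsUnitFactorization m α p n) :
    ∃ ρ > 0, ∀ (f : MvPolynomial (Fin ℓ) ℂ) (ε : ℝ),
      pNorm (f - α • ∏ i, p i ^ n i) < ρ →
      ENNReal.ofReal (pNorm (f - α • ∏ i, p i ^ n i)) ≤ theta m (α • ∏ i, p i ^ n i) / 2 →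
      distE f (FMset s (fun i => multideg (p i)) n) < ENNReal.ofReal ε →
      ENNReal.ofReal ε < theta m (α • ∏ i, p i ^ n i) / 2 →
      ∃ (β : ℂ) (r : ℕ) (fs : Fin r → MvPolynomial (Fin ℓ) ℂ) (ks : Fin r → ℕ),
        IsNIF m f ε β r fs ks := by
  obtain ⟨η, hη, hstable⟩ := H.exists_factors_stable
  obtain ⟨ρ, hρ, hnear⟩ := H.exists_factorMap_eq (half_pos hη)
  have hf₀ : 0 < pNorm (α • ∏ i, p i ^ n i) :=
    pNorm_pos (smul_ne_zero H.scalar_ne_zero (prod_pow_ne_zero (fun i => (H.irreducible i).ne_zero) n))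
  refine ⟨min (ρ / 2) (pNorm (α • ∏ i, p i ^ n i) / 2), lt_min (half_pos hρ) (half_pos hf₀),
    fun f ε hf hfθ hdist hε => ?_⟩
  have hfρ := hf.trans_le (min_le_left _ _)
  have hf2 := hf.trans_le (min_le_right _ _)
  have : ProperSpace (ℂ × ((i : Fin s) → orthBox (p i))) := FiniteDimensional.proper ℂ _
  have hcont : Continuous fun y => pNorm (f - factorMap α p n y) :=
    continuous_norm.comp ((toL2CLM ℓ).continuous.comp
      (continuous_const.sub (contDiff_factorMap α p n).continuous))
  obtain ⟨x, hxball, hxmin⟩ := (isCompact_closedBall (0 : ℂ × ((i : Fin s) → orthBox (p i)))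
    (η / 2)).exists_isMinOn ⟨0, Metric.mem_closedBall_self (half_pos hη).le⟩ hcont.continuousOn
  have hxη : ‖x‖ < η := (mem_closedBall_zero_iff.1 hxball).trans_lt (half_lt_self hη)
  obtain ⟨hx0, hxirr, hxdeg, hxna⟩ := hstable x hxη
  have hxcenter : pNorm (f - factorMap α p n x) ≤ pNorm (f - α • ∏ i, p i ^ n i) := by
    have h := isMinOn_iff.1 hxmin 0 (Metric.mem_closedBall_self (half_pos hη).le)
    rwa [factorMap_zero] at h
  have hmem : factorMap α p n x ∈ FMset s (fun i => multideg (p i)) n :=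
    smul_prod_mem_FMset hxirr hxdeg hxna hx0
  have hle : ∀ g ∈ FMset s (fun i => multideg (p i)) n,
      pNorm (f - factorMap α p n x) ≤ pNorm (f - g) := by
    rintro _ ⟨γ, F, -, hF, hFd, -, rfl⟩
    rw [← MvPolynomial.smul_eq_C_mul]
    rcases le_total (pNorm (f - γ • ∏ i, F i ^ n i)) (pNorm (f - α • ∏ i, p i ^ n i)) with h | h
    · obtain ⟨-, y, hy, heq, -⟩ := hnear γ F (fun i => (hF i).ne_zero)
        (fun i => funext (hFd i)) (by
          have := pNorm_sub_le (α • ∏ i, p i ^ n i) f (γ • ∏ i, F i ^ n i)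
          rw [pNorm_sub_comm _ f] at this
          linarith)
      rw [heq]
      exact isMinOn_iff.1 hxmin y (mem_closedBall_zero_iff.2 hy.le)
    · exact hxcenter.trans h
  have hdeq : distE f (FMset s (fun i => multideg (p i)) n) =
      ENNReal.ofReal (pNorm (f - factorMap α p n x)) :=
    le_antisymm (distE_le hmem f) (le_iInf₂ fun g hg => ENNReal.ofReal_le_ofReal (hle g hg))
  have hdeg : (fun j t => (p j + (x.2 j : MvPolynomial (Fin ℓ) ℂ)).degreeOf t) =
      fun i => multideg (p i) := funext hxdeg
  refine ⟨1, s, fun i => p i + x.2 i, n, one_ne_zero, hxirr, hxna, ?_⟩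
  rw [hdeg]
  refine ⟨H.isStruct, fun r mdeg k hst hlt => ?_, ⟨(1 + x.1) * α, fun γ => ?_, ?_⟩, hdist⟩
  · exact (codimOf_le_of_mem_pclosure H.irreducible H.not_associated H.scalar_ne_zero H.isStruct
      hst (mem_pclosure_of_distE_lt hst hlt hε hfθ)).1
  · rw [← MvPolynomial.smul_eq_C_mul, ← MvPolynomial.smul_eq_C_mul]
    rcases eq_or_ne γ 0 with rfl | hγ
    · have h := pNorm_sub_le (α • ∏ i, p i ^ n i) f 0
      rw [sub_zero, sub_zero, pNorm_sub_comm _ f] at h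
      rw [zero_smul, sub_zero]
      exact hxcenter.trans (by linarith)
    · exact hle _ (smul_prod_mem_FMset hxirr hxdeg hxna hγ)
  · rw [hdeq, ← MvPolynomial.smul_eq_C_mul, factorMap]

/-- Numerical factorizations depend in a Lipschitz way on the data near `α ∏ pᵢ ^ nᵢ`. -/
theorem exists_factDistL_le (H : IsUnitFactorization m α p n) :
    ∃ ρ > 0, ∃ L ≥ 0, ∀ (f f' : MvPolynomial (Fin ℓ) ℂ) (ε ε' : ℝ) (β : ℂ) (r : ℕ)
      (fs : Fin r → MvPolynomial (Fin ℓ) ℂ) (ks : Fin r → ℕ) (β' : ℂ) (r' : ℕ)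
      (fs' : Fin r' → MvPolynomial (Fin ℓ) ℂ) (ks' : Fin r' → ℕ),
      pNorm (f - α • ∏ i, p i ^ n i) < ρ →
      ENNReal.ofReal (pNorm (f - α • ∏ i, p i ^ n i)) ≤ theta m (α • ∏ i, p i ^ n i) / 2 →
      distE f (FMset s (fun i => multideg (p i)) n) < ENNReal.ofReal ε →
      ENNReal.ofReal ε < theta m (α • ∏ i, p i ^ n i) / 2 →
      pNorm (f' - α • ∏ i, p i ^ n i) < ρ →
      ENNReal.ofReal (pNorm (f' - α • ∏ i, p i ^ n i)) ≤ theta m (α • ∏ i, p i ^ n i) / 2 →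
      distE f' (FMset s (fun i => multideg (p i)) n) < ENNReal.ofReal ε' →
      ENNReal.ofReal ε' < theta m (α • ∏ i, p i ^ n i) / 2 →
      IsNIF m f ε β r fs ks → IsNIF m f' ε' β' r' fs' ks' →
      factDistL (fullList r fs ks) (fullList r' fs' ks') ≤ L * pNorm (f - f') := by
  obtain ⟨η₁, hη₁, hstable⟩ := H.exists_factors_stable
  obtain ⟨η₂, hη₂, ρ₂, hρ₂, L, hL, hLip⟩ := exists_lipschitz_factorMap H.scalar_ne_zero
    H.irreducible H.not_associated H.isStruct.2.2.1 H.pNorm_eq_one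
  obtain ⟨ρ₁, hρ₁, hcoord⟩ := H.exists_coordinates_of_isNIF (lt_min hη₁ hη₂) fun x hx => by
    obtain ⟨h0, hirr, hdeg, hna⟩ := hstable x (hx.trans_le (min_le_left _ _))
    exact smul_prod_mem_FMset hirr hdeg hna h0
  refine ⟨min ρ₁ ρ₂, lt_min hρ₁ hρ₂, L, hL, ?_⟩
  intro f f' ε ε' β r fs ks β' r' fs' ks' hf hfθ hdist hε hf' hfθ' hdist' hε' hNIF hNIF'
  obtain ⟨e, x, hx, hk, hc, hmin, -⟩ :=
    hcoord f ε β r fs ks (hf.trans_le (min_le_left _ _)) hfθ hdist hε hNIF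
  obtain ⟨e', x', hx', hk', hc', hmin', hle'⟩ :=
    hcoord f' ε' β' r' fs' ks' (hf'.trans_le (min_le_left _ _)) hfθ' hdist' hε' hNIF'
  refine (factDistL_fullList_le (e.trans e'.symm) (fun j => ?_) (norm_nonneg (x - x'))
    fun j => ?_).trans (hLip f f' x x' (hx.trans_le (min_le_right _ _))
      (hx'.trans_le (min_le_right _ _)) (hle'.trans (hf'.le.trans (min_le_right _ _))) hmin hmin')
  · rw [hk, hk', Equiv.trans_apply, Equiv.apply_symm_apply]
  · obtain ⟨c, hc0, hc⟩ := hc j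
    obtain ⟨c', -, hc'⟩ := hc' ((e.trans e'.symm) j)
    rw [Equiv.trans_apply, Equiv.apply_symm_apply] at hc'
    exact H.psin_le_norm_sub (hNIF'.2.1 _).ne_zero hc0 hc hc'

end IsUnitFactorization

end WellPosedness

/-- Numerical Factorization Theorem, part (ii): well-posedness. Near `f̃ ∈ F^𝔑` there are a
(ball) neighborhood and a Lipschitz constant `L` such that (a) `δ_f := dist(f,F^𝔑)` is at
most `‖f − f̃‖`; (b) for `δ_f < ε < θ_{f̃}/2` a numerical irreducible factorization of `f`
within `ε` exists and is unique up to equivalence (any two have factorization distance `0`);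
(c) numerical factorizations of nearby data are within factorization distance
`L·‖f − f'‖` of each other. -/
theorem numerical_factorization_well_posed (ℓ : ℕ) (hl : 1 ≤ ℓ) (m : Fin ℓ → ℕ)
    (hm : m ≠ 0) (rN : ℕ) (ndeg : Fin rN → Fin ℓ → ℕ) (nk : Fin rN → ℕ)
    (hN : IsStruct m rN ndeg nk)
    (ft : MvPolynomial (Fin ℓ) ℂ) (hft : ft ∈ FMset rN ndeg nk) :
    ∃ ρ L : ℝ, 0 < ρ ∧ 0 ≤ L ∧
      (∀ f : MvPolynomial (Fin ℓ) ℂ, (∀ t, f.degreeOf t ≤ m t) → pNorm (f - ft) < ρ →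
        (distE f (FMset rN ndeg nk) ≤ ENNReal.ofReal (pNorm (f - ft))) ∧
        (∀ ε : ℝ, distE f (FMset rN ndeg nk) < ENNReal.ofReal ε →
          ENNReal.ofReal ε < theta m ft / 2 →
          (∃ (α : ℂ) (r : ℕ) (fs : Fin r → MvPolynomial (Fin ℓ) ℂ) (ks : Fin r → ℕ),
            IsNIF m f ε α r fs ks) ∧
          (∀ (α : ℂ) (r : ℕ) (fs : Fin r → MvPolynomial (Fin ℓ) ℂ) (ks : Fin r → ℕ)
              (α' : ℂ) (r' : ℕ) (fs' : Fin r' → MvPolynomial (Fin ℓ) ℂ) (ks' : Fin r' → ℕ),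
            IsNIF m f ε α r fs ks → IsNIF m f ε α' r' fs' ks' →
            factDistL (fullList r fs ks) (fullList r' fs' ks') = 0))) ∧
      (∀ f f' : MvPolynomial (Fin ℓ) ℂ,
        (∀ t, f.degreeOf t ≤ m t) → (∀ t, f'.degreeOf t ≤ m t) →
        pNorm (f - ft) < ρ → pNorm (f' - ft) < ρ →
        ∀ ε ε' : ℝ,
          distE f (FMset rN ndeg nk) < ENNReal.ofReal ε →
          ENNReal.ofReal ε < theta m ft / 2 →
          distE f' (FMset rN ndeg nk) < ENNReal.ofReal ε' →
          ENNReal.ofReal ε' < theta m ft / 2 →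
          ∀ (α : ℂ) (r : ℕ) (fs : Fin r → MvPolynomial (Fin ℓ) ℂ) (ks : Fin r → ℕ)
            (α' : ℂ) (r' : ℕ) (fs' : Fin r' → MvPolynomial (Fin ℓ) ℂ) (ks' : Fin r' → ℕ),
            IsNIF m f ε α r fs ks → IsNIF m f' ε' α' r' fs' ks' →
            factDistL (fullList r fs ks) (fullList r' fs' ks') ≤ L * pNorm (f - f')) := by
  obtain ⟨α, p, H, rfl, rfl⟩ := exists_isUnitFactorization hN hft
  obtain ⟨ρ₀, hρ₀, hθ⟩ := exists_pos_ofReal_le (theta m (α • ∏ i, p i ^ nk i) / 2)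
  obtain ⟨ρ₁, hρ₁, hex⟩ := H.exists_isNIF
  obtain ⟨ρ₂, hρ₂, L, hL, hLip⟩ := H.exists_factDistL_le
  have hlt : ∀ {x : ℝ}, x < min ρ₀ (min ρ₁ ρ₂) → x < ρ₀ ∧ x < ρ₁ ∧ x < ρ₂ := fun h => by
    simpa only [lt_min_iff] using h
  have hnear : ∀ {x ε : ℝ}, x < ρ₀ → ENNReal.ofReal ε < theta m (α • ∏ i, p i ^ nk i) / 2 →
      ENNReal.ofReal x ≤ theta m (α • ∏ i, p i ^ nk i) / 2 := fun hx hε =>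
    (ENNReal.ofReal_le_ofReal hx.le).trans (hθ hε.ne_bot)
  refine ⟨min ρ₀ (min ρ₁ ρ₂), L, lt_min hρ₀ (lt_min hρ₁ hρ₂), hL,
    fun f _ hf => ⟨distE_le hft f, fun ε hdist hε => ⟨?_, ?_⟩⟩, ?_⟩
  · exact hex f ε (hlt hf).2.1 (hnear (hlt hf).1 hε) hdist hε
  · intro β r fs ks β' r' fs' ks' hNIF hNIF'
    refine le_antisymm ?_ (factDistL_nonneg _ _)
    have h := hLip f f ε ε β r fs ks β' r' fs' ks' (hlt hf).2.2 (hnear (hlt hf).1 hε) hdist hε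
      (hlt hf).2.2 (hnear (hlt hf).1 hε) hdist hε hNIF hNIF'
    rwa [sub_self, ← norm_toL2, map_zero, norm_zero, mul_zero] at h
  · intro f f' _ _ hf hf' ε ε' hdist hε hdist' hε' β r fs ks β' r' fs' ks' hNIF hNIF'
    exact hLip f f' ε ε' β r fs ks β' r' fs' ks' (hlt hf).2.2 (hnear (hlt hf).1 hε) hdist hε
      (hlt hf').2.2 (hnear (hlt hf').1 hε') hdist' hε' hNIF hNIF'
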